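/- Let G be a finite solvable group with subgroups H and K that are isomorphic as abstract groups, where H is a maximal subgroup of G with index |G : H| = p^n for a prime p ≤ 3 and a positive integer n. Set q = 5 − p. If the q-part of |G| satisfies |G|_q ≤ q^4, then K is also a maximal subgroup of G. (Theorem 1.4) -/

import Mathlib

section

open Subgroup

section pCore

variable {G : Type*} [Group G]

/-- The largest normal `p`-subgroup of a subgroup `L`, as a subgroup of the ambient group. -/
def pCore (p : ℕ) (L : Subgroup G) : Subgroup G :=
  sSup {N | N ≤ L ∧ L ≤ normalizer (N : Set G) ∧ IsPGroup p N}

theorem le_pCore {p : ℕ} {L N : Subgroup G} (h1 : N ≤ L) (h2 : L ≤ normalizer (N : Set G))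
    (h3 : IsPGroup p N) : N ≤ pCore p L :=
  le_sSup ⟨h1, h2, h3⟩

theorem le_pCore_top {p : ℕ} {N : Subgroup G} [hN : N.Normal] (h : IsPGroup p N) :
    N ≤ pCore p (⊤ : Subgroup G) :=
  le_pCore le_top le_normalizer_of_normal h

theorem pCore_le (p : ℕ) (L : Subgroup G) : pCore p L ≤ L :=
  sSup_le fun _ h => h.1

theorem le_normalizer_pCore (p : ℕ) (L : Subgroup G) :
    L ≤ normalizer (pCore p L : Set G) := by
  intro g hg
  rw [mem_normalizer_iff_map_conj_eq]
  have key : ∀ g ∈ L, (pCore p L).map (MulAut.conj g).toMonoidHom ≤ pCore p L := by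
    intro g hg
    rw [map_le_iff_le_comap]
    refine sSup_le fun N hN => ?_
    rw [← map_le_iff_le_comap]
    have := mem_normalizer_iff_map_conj_eq.1 (hN.2.1 hg)
    have h2 : N.map (MulAut.conj g).toMonoidHom = N := this
    rw [h2]
    exact le_sSup hN
  refine le_antisymm (key g hg) ?_
  intro x hx
  refine ⟨g⁻¹ * x * g, ?_, by simp [mul_assoc]⟩
  have := key g⁻¹ (inv_mem hg) ⟨x, hx, rfl⟩
  simpa using this

instance pCore_top_normal (p : ℕ) : (pCore p (⊤ : Subgroup G)).Normal :=
  normalizer_eq_top_iff.1 (top_le_iff.1 (le_normalizer_pCore p ⊤))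

theorem isPGroup_pCore (p : ℕ) (L : Subgroup G) : IsPGroup p (pCore p L) := by
  obtain ⟨Q⟩ : Nonempty (Sylow p L) := inferInstance
  have : pCore p L ≤ (Q : Subgroup L).map L.subtype := by
    refine sSup_le fun N hN => ?_
    have hn : (N.subgroupOf L).Normal := (normal_subgroupOf_iff_le_normalizer hN.1).2 hN.2.1
    have h1 : N.subgroupOf L ≤ Q :=
      IsPGroup.le_sylow_of_normal (N := N.subgroupOf L) (hN.2.2.comap_subtype (K := L)) Q
    calc N = (N.subgroupOf L).map L.subtype := by
            rw [subgroupOf_map_subtype, inf_eq_left.2 hN.1]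
      _ ≤ _ := map_mono h1
  exact (Q.isPGroup'.map L.subtype).to_le this

theorem le_normalizer_map_of_injective {A : Type*} [Group A] {f : A →* G}
    {N L : Subgroup A} (h : L ≤ normalizer (N : Set A)) :
    L.map f ≤ normalizer (N.map f : Set G) :=
  (map_mono h).trans (le_normalizer_map f)

theorem map_pCore {A : Type*} [Group A] {f : A →* G} (hf : Function.Injective f) (p : ℕ)
    (L : Subgroup A) : (pCore p L).map f = pCore p (L.map f) := by
  apply le_antisymm
  · exact le_pCore (map_mono (pCore_le p L))
      (le_normalizer_map_of_injective (le_normalizer_pCore p L)) ((isPGroup_pCore p L).map f)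
  · have h0 : pCore p (L.map f) ≤ f.range := (pCore_le _ _).trans (map_le_range f L)
    rw [← map_comap_eq_self h0]
    refine map_mono (le_pCore ?_ ?_ ((isPGroup_pCore _ _).comap_of_injective f hf))
    · have := comap_mono (f := f) (pCore_le p (L.map f))
      rwa [comap_map_eq_self_of_injective hf] at this
    · have := comap_mono (f := f) (le_normalizer_pCore p (L.map f))
      rw [comap_map_eq_self_of_injective hf] at this
      exact this.trans (le_normalizer_comap f)

theorem map_pCore_top {A : Type*} [Group A] {f : A →* G} (hf : Function.Injective f) (p : ℕ) :
    (pCore p (⊤ : Subgroup A)).map f = pCore p f.range := by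
  rw [map_pCore hf, MonoidHom.range_eq_map]

theorem normal_pCore_of_normal (p : ℕ) {M : Subgroup G} [M.Normal] : (pCore p M).Normal := by
  refine ⟨fun x hx g => ?_⟩
  have h1 : M.map (MulAut.conj g).toMonoidHom = M :=
    mem_normalizer_iff_map_conj_eq.1 (by rw [normalizer_eq_top]; trivial)
  have h2 := map_pCore (f := (MulAut.conj g).toMonoidHom) (MulAut.conj g).injective p M
  rw [h1] at h2
  rw [← h2]
  exact ⟨x, hx, rfl⟩

theorem pCore_le_of_normal (p : ℕ) (M : Subgroup G) [M.Normal] :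
    pCore p M ≤ pCore p ⊤ :=
  have := normal_pCore_of_normal p (M := M)
  le_pCore_top (isPGroup_pCore p M)

theorem normal_sylow_le_pCore {p : ℕ} {M : Subgroup G} [M.Normal] {T : Subgroup G}
    (hT : IsPGroup p T) (hTM : T ≤ M)
    (h : ∀ Q : Sylow p M, (Q : Subgroup M).Normal) : T ≤ pCore p ⊤ := by
  obtain ⟨Q, hQ⟩ := IsPGroup.exists_le_sylow (hT.comap_subtype (K := M))
  have hn : ((Q : Subgroup M).map M.subtype) ≤ pCore p M := by
    refine le_pCore (map_subtype_le _) ?_ (Q.isPGroup'.map _)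
    have := h Q
    have h2 := le_normalizer_map_of_injective (f := M.subtype)
      (le_normalizer_of_normal (H := (Q : Subgroup M)) (K := ⊤))
    rwa [← MonoidHom.range_eq_map, M.range_subtype] at h2
  calc T = (T.subgroupOf M).map M.subtype := by
            rw [subgroupOf_map_subtype, inf_eq_left.2 hTM]
    _ ≤ _ := map_mono hQ
    _ ≤ _ := hn
    _ ≤ _ := pCore_le_of_normal p M

theorem eq_top_of_sylow_le [Finite G] {L : Subgroup G}
    (h : ∀ p, p.Prime → ∃ Q : Sylow p G, (Q : Subgroup G) ≤ L) : L = ⊤ := by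
  rw [← index_eq_one]
  by_contra hne
  obtain ⟨p, hp, hpd⟩ := Nat.exists_prime_and_dvd hne
  obtain ⟨Q, hQ⟩ := h p hp
  have := Fact.mk hp
  exact Q.not_dvd_index (hpd.trans (index_dvd_of_le hQ))

/-- The intersection of the centralizers of all `O_r(G)`. -/
def pCoresCentralizer (G : Type*) [Group G] : Subgroup G :=
  ⨅ r : {r : ℕ // r.Prime}, centralizer (pCore r.1 (⊤ : Subgroup G) : Set G)

instance : (pCoresCentralizer G).Normal :=
  normal_iInf_normal fun _ => inferInstance

theorem pCoresCentralizer_le {r : ℕ} (hr : r.Prime) :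
    pCoresCentralizer G ≤ centralizer (pCore r (⊤ : Subgroup G) : Set G) :=
  iInf_le _ (⟨r, hr⟩ : {r : ℕ // r.Prime})

theorem le_pCoresCentralizer {X : Subgroup G}
    (h : ∀ r, r.Prime → X ≤ centralizer (pCore r (⊤ : Subgroup G) : Set G)) :
    X ≤ pCoresCentralizer G := by
  rw [pCoresCentralizer]
  exact le_iInf fun r => h r r.2

theorem sylow_normal_of_commutator_le_center {D : Type*} [Group D] [Finite D]
    (h : commutator D ≤ center D) {p : ℕ} [Fact p.Prime] (P : Sylow p D) :
    (P : Subgroup D).Normal := by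
  have : Group.IsNilpotent D := by
    refine Subgroup.isNilpotent_of_ker_le_center (Abelianization.of : D →* Abelianization D) ?_
    rwa [Abelianization.ker_of]
  infer_instance

theorem pCoresCentralizer_le_centralizer [Finite G] [Group.IsSolvable G] :
    pCoresCentralizer G ≤ centralizer (pCoresCentralizer G : Set G) := by
  set C := pCoresCentralizer G with hC
  by_contra hne
  obtain ⟨D, hD⟩ := Set.Finite.exists_minimal
    (Set.toFinite {D : Subgroup G | D.Normal ∧ D ≤ C ∧ ¬ D ≤ centralizer (C : Set G)})
    ⟨C, inferInstance, le_rfl, hne⟩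
  obtain ⟨hDn, hDC, hDne⟩ := hD.1
  have hDbot : D ≠ ⊥ := by rintro rfl; exact hDne bot_le
  have hlt := Group.IsSolvable.commutator_lt_of_ne_bot hDbot
  have h1 : ⁅D, D⁆ ≤ centralizer (C : Set G) := by
    by_contra h
    exact hlt.not_ge (hD.2 ⟨inferInstance, hlt.le.trans hDC, h⟩ hlt.le)
  have hcomm : commutator D ≤ center D := by
    intro x hx
    have hx' : (x : G) ∈ ⁅D, D⁆ := by
      have := mem_map_of_mem D.subtype hx
      rw [map_subtype_commutator] at this
      exact this
    rw [mem_center_iff]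
    intro y
    exact Subtype.ext (mem_centralizer_iff.1 (h1 hx') y (hDC y.2))
  apply hDne
  rw [← subgroupOf_eq_top]
  apply eq_top_of_sylow_le
  intro p hp
  have := Fact.mk hp
  obtain ⟨Q⟩ : Nonempty (Sylow p D) := inferInstance
  refine ⟨Q, ?_⟩
  rw [subgroupOf, ← map_le_iff_le_comap, le_centralizer_iff]
  have h3 : (Q : Subgroup D).map D.subtype ≤ pCore p ⊤ :=
    normal_sylow_le_pCore (Q.isPGroup'.map _) (map_subtype_le _)
      (fun Q => sylow_normal_of_commutator_le_center hcomm Q)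
  exact (pCoresCentralizer_le hp).trans (centralizer_le h3)

theorem le_pCore_of_le_pCoresCentralizer [Finite G] [Group.IsSolvable G] {t : ℕ} {T : Subgroup G}
    (hT : IsPGroup t T) (h : T ≤ pCoresCentralizer G) : T ≤ pCore t ⊤ := by
  refine normal_sylow_le_pCore hT h fun Q => ?_
  refine ⟨fun x hx g => ?_⟩
  have : g * x = x * g := Subtype.ext
    (mem_centralizer_iff.1 (pCoresCentralizer_le_centralizer x.2) g g.2)
  rw [this]; simpa using hx

theorem le_pCore_of_forall_le_centralizer [Finite G] [Group.IsSolvable G] {t : ℕ} {T : Subgroup G}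
    (hT : IsPGroup t T)
    (h : ∀ r, r.Prime → T ≤ centralizer (pCore r (⊤ : Subgroup G) : Set G)) : T ≤ pCore t ⊤ :=
  le_pCore_of_le_pCoresCentralizer hT (le_iInf fun r => h r.1 r.2)

theorem relIndex_dvd_index_of_normal_right [Finite G] (L M : Subgroup G) [M.Normal] :
    L.relIndex M ∣ L.index := by
  have h1 := relIndex_mul_relIndex (L ⊓ M) M (L ⊔ M) inf_le_right le_sup_right
  have h2 := relIndex_mul_relIndex (L ⊓ M) L (L ⊔ M) inf_le_left le_sup_left
  rw [relIndex_sup_right, inf_relIndex_right] at h1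
  rw [inf_relIndex_left] at h2
  have h3 : M.relIndex L ≠ 0 := index_ne_zero_of_finite
  have h4 : L.relIndex M = L.relIndex (L ⊔ M) := by
    rw [← h1, mul_comm] at h2
    exact (mul_right_cancel₀ h3 h2).symm
  rw [h4]
  exact relIndex_dvd_index_of_le le_sup_left

/-- A normal subgroup of order prime to the index of `L` lies in `L`. -/
theorem le_of_coprime_index [Finite G] {M L : Subgroup G} [M.Normal]
    (h : (Nat.card M).Coprime L.index) : M ≤ L := by
  rw [← relIndex_eq_one]
  apply Nat.eq_one_of_dvd_coprimes h
  · exact relIndex_dvd_card L M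
  · exact relIndex_dvd_index_of_normal_right L M

theorem le_of_isPGroup_of_index [Finite G] {M L : Subgroup G} [M.Normal] {r p n : ℕ}
    (hr : r.Prime) (hp : p.Prime) (hrp : r ≠ p) (hM : IsPGroup r M) (hL : L.index = p ^ n) :
    M ≤ L := by
  have := Fact.mk hr
  obtain ⟨k, hk⟩ := IsPGroup.iff_card.1 hM
  apply le_of_coprime_index
  rw [hk, hL]
  exact Nat.Coprime.pow _ _ ((Nat.coprime_primes hr hp).2 hrp)

theorem le_centralizer_of_disjoint {M N : Subgroup G} (h : Disjoint M N)
    (h1 : M ≤ normalizer (N : Set G)) (h2 : N ≤ normalizer (M : Set G)) :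
    M ≤ centralizer (N : Set G) := by
  rw [← commutator_eq_bot_iff_le_centralizer, eq_bot_iff]
  rw [disjoint_iff_inf_le] at h
  refine le_trans (le_inf ?_ ?_) h
  · exact le_normalizer_iff_commutator_le_left.1 h2
  · exact le_normalizer_iff_commutator_le_right.1 h1

/-- In a solvable group, `O_p` of a subgroup of `p`-power index lies in `O_p` of the group,
when the latter is trivial. -/
theorem pCore_eq_bot_of_index [Finite G] [Group.IsSolvable G] {p n : ℕ} (hp : p.Prime)
    {L : Subgroup G} (hL : L.index = p ^ n) (hG : pCore p (⊤ : Subgroup G) = ⊥) :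
    pCore p L = ⊥ := by
  rw [eq_bot_iff, ← hG]
  apply le_pCore_of_forall_le_centralizer (isPGroup_pCore p L)
  intro r hr
  by_cases hrp : r = p
  · subst hrp
    rw [hG]
    intro x _
    simp [mem_centralizer_iff]
  have hrL : pCore r (⊤ : Subgroup G) ≤ L :=
    le_of_isPGroup_of_index hr hp hrp (isPGroup_pCore _ _) hL
  have := Fact.mk hr
  have := Fact.mk hp
  exact le_centralizer_of_disjoint
    (IsPGroup.disjoint_of_ne p r (Ne.symm hrp) _ _ (isPGroup_pCore _ _) (isPGroup_pCore _ _))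
    le_normalizer_of_normal (hrL.trans (le_normalizer_pCore p L))

theorem pCore_quotient_self [Finite G] (p : ℕ) [Fact p.Prime] :
    pCore p (⊤ : Subgroup (G ⧸ pCore p (⊤ : Subgroup G))) = ⊥ := by
  set U := pCore p (⊤ : Subgroup G)
  rw [eq_bot_iff]
  have h : (pCore p (⊤ : Subgroup (G ⧸ U))).comap (QuotientGroup.mk' U) ≤ U := by
    refine le_pCore_top ?_
    refine (isPGroup_pCore p _).comap_of_ker_isPGroup _ ?_
    rw [QuotientGroup.ker_mk']
    exact isPGroup_pCore p _
  intro x hx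
  obtain ⟨g, rfl⟩ := QuotientGroup.mk'_surjective U x
  exact (QuotientGroup.eq_one_iff g).2 (h hx)

theorem pCore_le_of_index [Finite G] [Group.IsSolvable G] {p n : ℕ} (hp : p.Prime)
    {L : Subgroup G} (hL : L.index = p ^ n) : pCore p L ≤ pCore p ⊤ := by
  have := Fact.mk hp
  set U := pCore p (⊤ : Subgroup G) with hU
  have h1 : ∃ m, (L.map (QuotientGroup.mk' U)).index = p ^ m := by
    have : (L.map (QuotientGroup.mk' U)).index ∣ p ^ n := by
      rw [← hL]
      exact index_map_dvd L (QuotientGroup.mk'_surjective U)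
    obtain ⟨m, -, hm⟩ := (Nat.dvd_prime_pow hp).1 this
    exact ⟨m, hm⟩
  obtain ⟨m, hm⟩ := h1
  have h2 := pCore_eq_bot_of_index hp hm (pCore_quotient_self p)
  have h3 : (pCore p L).map (QuotientGroup.mk' U) ≤ pCore p (L.map (QuotientGroup.mk' U)) :=
    le_pCore (map_mono (pCore_le p L))
      (le_normalizer_map_of_injective (le_normalizer_pCore p L)) ((isPGroup_pCore p L).map _)
  rw [h2, le_bot_iff, Subgroup.map_eq_bot_iff, QuotientGroup.ker_mk'] at h3
  exact h3

end pCore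

section Reduction

/-- Every subgroup isomorphic to a maximal subgroup of index `p ^ n` is maximal; both subgroups are
presented as images of injective homomorphisms. -/
def MaximalTransfer (p n : ℕ) (G : Type) [Group G] : Prop :=
  ∀ (A : Type) [Group A] (ι φ : A →* G), Function.Injective ι → Function.Injective φ →
    IsCoatom ι.range → ι.range.index = p ^ n → IsCoatom φ.range

variable {G A : Type} [Group G] [Finite G] [Group A] {ι φ : A →* G} {p n : ℕ}

theorem card_range_of_injective {B : Type*} [Group B] {f : A →* B} (hf : Function.Injective f) :
    Nat.card f.range = Nat.card A :=
  (Nat.card_congr (f.ofInjective hf).toEquiv).symm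

theorem eq_of_le_of_card_eq {X Y : Subgroup G} (h : X ≤ Y) (hc : Nat.card X = Nat.card Y) :
    X = Y :=
  eq_of_le_of_card_ge h hc.ge

omit [Finite G] in
theorem isCoatom_map_of_surjective {B : Type*} [Group B] {f : G →* B}
    (hf : Function.Surjective f) {M : Subgroup G} (hM : IsCoatom M) (hk : f.ker ≤ M) :
    IsCoatom (M.map f) := by
  refine ⟨fun h => hM.1 ?_, fun L hL => ?_⟩
  · rw [← comap_map_eq_self hk, h, comap_top]
  · have h1 : M < L.comap f := by
      rw [← comap_map_eq_self hk]
      exact (comap_lt_comap_of_surjective hf).2 hL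
    have h2 := hM.2 _ h1
    rw [← map_comap_eq_self_of_surjective hf L, h2, map_top_of_surjective f hf]

omit [Finite G] in
theorem isCoatom_range_of_map_eq_normal
    (hι : Function.Injective ι) (hφ : Function.Injective φ) (hH : IsCoatom ι.range)
    (hidx : ι.range.index = p ^ n) {X : Subgroup A} (hX : X.map φ = X.map ι)
    [hN : (X.map ι).Normal] (h : MaximalTransfer p n (G ⧸ X.map ι)) : IsCoatom φ.range := by
  have hXι : X = (X.map ι).comap ι := (comap_map_eq_self_of_injective hι X).symm
  have hXφ : X = (X.map ι).comap φ := by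
    rw [← hX]; exact (comap_map_eq_self_of_injective hφ X).symm
  have : X.Normal := by rw [hXι]; infer_instance
  have hkι : (QuotientGroup.mk' (X.map ι)).ker ≤ ι.range := by
    rw [QuotientGroup.ker_mk']; exact map_le_range ι X
  have hkφ : (QuotientGroup.mk' (X.map ι)).ker ≤ φ.range := by
    rw [QuotientGroup.ker_mk', ← hX]; exact map_le_range φ X
  have hsurj := QuotientGroup.mk'_surjective (X.map ι)
  have hinj : ∀ f : A →* G, (hf : X = (X.map ι).comap f) →
      Function.Injective (QuotientGroup.map X (X.map ι) f hf.le) := by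
    intro f hf
    rw [injective_iff_map_eq_one]
    intro a
    induction a using QuotientGroup.induction_on with
    | H a =>
      rw [QuotientGroup.map_mk, QuotientGroup.eq_one_iff, QuotientGroup.eq_one_iff]
      intro ha
      rw [hf]; exact ha
  have hrange : ∀ f : A →* G, (hf : X = (X.map ι).comap f) →
      (QuotientGroup.map X (X.map ι) f hf.le).range =
        f.range.map (QuotientGroup.mk' (X.map ι)) := by
    intro f hf
    have h1 : (QuotientGroup.map X (X.map ι) f hf.le).comp (QuotientGroup.mk' X) =
        (QuotientGroup.mk' (X.map ι)).comp f := rfl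
    rw [← MonoidHom.range_comp, ← h1, MonoidHom.range_comp,
      MonoidHom.range_eq_top.2 (QuotientGroup.mk'_surjective X), ← MonoidHom.range_eq_map]
  have key := h (A ⧸ X) (QuotientGroup.map X (X.map ι) ι hXι.le)
    (QuotientGroup.map X (X.map ι) φ hXφ.le) (hinj ι hXι) (hinj φ hXφ)
    (by rw [hrange ι hXι]; exact isCoatom_map_of_surjective hsurj hH hkι)
    (by rw [hrange ι hXι, index_map_eq _ hsurj hkι, hidx])
  rw [hrange φ hXφ] at key
  rw [← comap_map_eq_self hkφ]
  exact isCoatom_comap_of_surjective hsurj key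

variable (IH : ∀ (N : Subgroup G) [N.Normal], N ≠ ⊥ → MaximalTransfer p n (G ⧸ N))

include IH in
theorem isCoatom_range_of_factorization
    (hι : Function.Injective ι) (hφ : Function.Injective φ) (hH : IsCoatom ι.range)
    (hidx : ι.range.index = p ^ n) {X : Subgroup A} (hX : X.map φ = X.map ι) (hX1 : X ≠ ⊥)
    (hfac : ∀ g : G, ∃ a : A, ∃ m ∈ normalizer (X.map ι : Set G), g = ι a * m) :
    IsCoatom φ.range := by
  set N := normalClosure (X.map ι : Set G) with hNdef
  set Y := normalClosure (X : Set A) with hYdef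
  have hN : ∀ f : A →* G, X.map f = X.map ι → Y.map f ≤ N := by
    intro f hf
    rw [map_le_iff_le_comap]
    refine normalClosure_le_normal fun x hx => ?_
    refine subset_normalClosure ?_
    rw [← hf]
    exact mem_map_of_mem f hx
  have h1 : N ≤ Y.map ι := by
    refine (closure_le _).2 ?_
    intro y hy
    obtain ⟨x, hx, hxy⟩ := Group.mem_conjugatesOfSet_iff.1 hy
    obtain ⟨g, rfl⟩ := isConj_iff.1 hxy
    obtain ⟨a, m, hm, rfl⟩ := hfac g
    obtain ⟨b, hb, hbx⟩ := (mem_normalizer_iff.1 hm x).1 hx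
    refine ⟨a * b * a⁻¹, ?_, ?_⟩
    · exact normalClosure_normal.conj_mem _ (subset_normalClosure hb) a
    · simp only [map_mul, map_inv, hbx]; group
  have h2 : Y.map ι = N := le_antisymm (hN ι rfl) h1
  have h3 : Y.map φ = N := by
    refine eq_of_le_of_card_eq (hN φ hX) ?_
    rw [card_map_of_injective hφ, ← h2, card_map_of_injective hι]
  have h4 : (Y.map ι).Normal := by rw [h2]; exact normalClosure_normal
  refine isCoatom_range_of_map_eq_normal hι hφ hH hidx (h3.trans h2.symm) (IH _ ?_)
  intro h
  rw [Subgroup.map_eq_bot_iff, (MonoidHom.ker_eq_bot_iff ι).2 hι, le_bot_iff] at h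
  exact hX1 (le_bot_iff.1 (h ▸ subset_normalClosure))

include IH in
theorem isCoatom_range_of_normal
    (hι : Function.Injective ι) (hφ : Function.Injective φ) (hH : IsCoatom ι.range)
    (hidx : ι.range.index = p ^ n) {X : Subgroup A} (hX : X.map φ = X.map ι) (hX1 : X ≠ ⊥)
    (hXn : X.Normal) : IsCoatom φ.range := by
  have hn : ∀ f : A →* G, f.range ≤ normalizer (X.map f : Set G) := fun f => by
    rw [MonoidHom.range_eq_map]
    exact le_normalizer_map_of_injective le_normalizer_of_normal
  have h1 := hn ι
  have h2 := hn φ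
  rw [hX] at h2
  rcases h1.eq_or_lt with h | h
  · rw [← h] at h2
    have : φ.range = ι.range := eq_of_le_of_card_eq h2 (by
      rw [card_range_of_injective hφ, card_range_of_injective hι])
    rwa [this]
  · have h3 := hH.2 _ h
    have : (X.map ι).Normal := normalizer_eq_top_iff.1 h3
    refine isCoatom_range_of_map_eq_normal hι hφ hH hidx hX (IH _ ?_)
    rwa [Ne, Subgroup.map_eq_bot_iff, (MonoidHom.ker_eq_bot_iff ι).2 hι, le_bot_iff]

end Reduction

section InvariantChain

variable {G : Type*} [Group G]

/-- `InvariantChain K m X` says that some chain `X₀ < X₁ < ⋯ < Xₘ = X` consists of subgroups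
normalized by `K`. -/
inductive InvariantChain (K : Subgroup G) : ℕ → Subgroup G → Prop
  | base {X : Subgroup G} (hX : K ≤ normalizer (X : Set G)) : InvariantChain K 0 X
  | step {m : ℕ} {X Y : Subgroup G} (hY : InvariantChain K m Y) (hlt : Y < X)
      (hX : K ≤ normalizer (X : Set G)) : InvariantChain K (m + 1) X

namespace InvariantChain

variable {K : Subgroup G} {m : ℕ} {X Y : Subgroup G}

theorem le_normalizer (h : InvariantChain K m X) : K ≤ normalizer (X : Set G) := by
  cases h <;> assumption

theorem pred (h : InvariantChain K (m + 1) X) : InvariantChain K m X := by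
  generalize hk : m + 1 = k at h
  induction h generalizing m with
  | base => omega
  | @step j X Y hY hlt hX ih =>
    obtain rfl : m = j := by omega
    cases m with
    | zero => exact base hX
    | succ i => exact step (ih rfl) hlt hX

theorem mono_length {k : ℕ} (h : InvariantChain K m X) (hk : k ≤ m) : InvariantChain K k X := by
  induction m with
  | zero => rwa [Nat.le_zero.1 hk]
  | succ m ih =>
    rcases hk.eq_or_lt with rfl | hlt
    · exact h
    · exact ih h.pred (by omega)

theorem mono_end (h : InvariantChain K m Y) (hle : Y ≤ X) (hX : K ≤ normalizer (X : Set G)) :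
    InvariantChain K m X := by
  rcases hle.eq_or_lt with rfl | hlt
  · exact h
  · exact (step h hlt hX).pred

theorem lt_card [Finite G] (h : InvariantChain K m X) : m < Nat.card X := by
  induction h with
  | base => exact Nat.card_pos
  | step _ hlt _ ih =>
    have h1 : Nat.card _ < Nat.card _ := Set.Finite.card_lt_card (Set.toFinite _) hlt
    exact lt_of_le_of_lt ih h1

theorem map {B : Type*} [Group B] {f : G →* B} (hf : Function.Injective f)
    (h : InvariantChain K m X) : InvariantChain (K.map f) m (X.map f) := by
  induction h with
  | base hX => exact base (le_normalizer_map_of_injective hX)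
  | step _ hlt hX ih =>
    exact step ih ((map_lt_map_iff_of_injective hf).2 hlt) (le_normalizer_map_of_injective hX)

theorem comap {B : Type*} [Group B] {f : B →* G}
    (h : InvariantChain K m X) (hX : X ≤ f.range) : InvariantChain (K.comap f) m (X.comap f) := by
  have aux : ∀ {X : Subgroup G}, K ≤ normalizer (X : Set G) →
      K.comap f ≤ normalizer (X.comap f : Set B) := fun h =>
    (comap_mono h).trans (le_normalizer_comap f)
  induction h with
  | base hX' => exact base (aux hX')
  | step _ hlt hX' ih =>
    refine step (ih (hlt.le.trans hX)) ((comap_mono hlt.le).lt_of_ne fun heq => hlt.ne ?_) (aux hX')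
    rw [← map_comap_eq_self hX, ← map_comap_eq_self (hlt.le.trans hX), heq]

theorem _root_.le_normalizer_inf_normal {N : Subgroup G} [N.Normal]
    (h : K ≤ normalizer (X : Set G)) : K ≤ normalizer ((X ⊓ N : Subgroup G) : Set G) := by
  rw [le_normalizer_iff] at h ⊢
  exact fun k hk x hx => ⟨h k hk x hx.1, Normal.conj_mem inferInstance x hx.2 k⟩

/-- Intersecting an invariant chain below `L` with `L₁`, where nothing invariant lies strictly
between, costs at most one step. -/
theorem inf (h : InvariantChain K m X) {L L₁ : Subgroup G} [L₁.Normal] (hL : X ≤ L)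
    (hirr : ∀ X ≤ L, K ≤ normalizer (X : Set G) → X ≤ L₁ ∨ X ⊔ L₁ = L) :
    ∃ k, m ≤ k + 1 ∧ InvariantChain K k (X ⊓ L₁) := by
  induction h with
  | base hX => exact ⟨0, by omega, base (le_normalizer_inf_normal hX)⟩
  | @step m X Y hY hlt hX ih =>
    rcases hirr Y (hlt.le.trans hL) hY.le_normalizer with h1 | h1
    · exact ⟨m, le_rfl, hY.mono_end (le_inf hlt.le h1) (le_normalizer_inf_normal hX)⟩
    · obtain ⟨k, hk, hc⟩ := ih (hlt.le.trans hL)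
      refine ⟨k + 1, by omega, step hc ((inf_le_inf_right _ hlt.le).lt_of_ne fun heq => ?_)
        (le_normalizer_inf_normal hX)⟩
      have h2 : X ≤ Y ⊔ L₁ := by rw [h1]; exact hL
      apply hlt.not_ge
      intro x hx
      obtain ⟨y, hy, l, hl, rfl⟩ := mem_sup_of_normal_right.1 (h2 hx)
      have : l ∈ X ⊓ L₁ := ⟨by simpa using mul_mem (inv_mem (hlt.le hy)) hx, hl⟩
      rw [← heq] at this
      exact mul_mem hy this.1

end InvariantChain

theorem commutator_le_iff_le_comap_centralizer {L U M : Subgroup G} [M.Normal] :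
    ⁅L, U⁆ ≤ M ↔
      L ≤ (centralizer (U.map (QuotientGroup.mk' M) : Set (G ⧸ M))).comap
        (QuotientGroup.mk' M) := by
  rw [← map_le_iff_le_comap, ← commutator_eq_bot_iff_le_centralizer, ← map_commutator,
    Subgroup.map_eq_bot_iff, QuotientGroup.ker_mk']

theorem lowerCentralSeries_normal {U : Subgroup G} [U.Normal] (n : ℕ) :
    (U.lowerCentralSeries n).Normal := by
  induction n with
  | zero => assumption
  | succ n ih => rw [Subgroup.lowerCentralSeries_succ]; infer_instance

theorem le_of_le_commutator_sup {L L₁ U : Subgroup G} [U.Normal] [L₁.Normal]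
    [Group.IsNilpotent U] (hLU : L ≤ U) (h : L ≤ ⁅L, U⁆ ⊔ L₁) : L ≤ L₁ := by
  have key : ∀ n, L ≤ U.lowerCentralSeries n ⊔ L₁ := by
    intro n
    induction n with
    | zero => exact hLU.trans le_sup_left
    | succ n ih =>
      have := lowerCentralSeries_normal (U := U) (n + 1)
      refine h.trans (sup_le ?_ le_sup_right)
      rw [commutator_le_iff_le_comap_centralizer]
      refine ih.trans (sup_le ?_ ?_)
      · rw [← commutator_le_iff_le_comap_centralizer, Subgroup.lowerCentralSeries_succ]
        exact le_sup_left
      · rw [← commutator_le_iff_le_comap_centralizer]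
        exact (commutator_le_left _ _).trans le_sup_right
  obtain ⟨n, hn⟩ := (isNilpotent_iff_lowerCentralSeries U).1 inferInstance
  have h2 := key n
  rwa [hn, bot_sup_eq] at h2

/-- A nilpotent normal subgroup acts trivially on chief factors below it, so these factors are
irreducible for any supplement. -/
theorem le_or_sup_eq_of_nilpotent {K U L L₁ : Subgroup G} [U.Normal] [L.Normal] [L₁.Normal]
    [Group.IsNilpotent U] (hKU : K ⊔ U = ⊤) (hLU : L ≤ U) (hL₁ : L₁ < L)
    (hchief : ∀ N : Subgroup G, N.Normal → L₁ ≤ N → N ≤ L → N = L₁ ∨ N = L)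
    {X : Subgroup G} (hXL : X ≤ L) (hX : K ≤ normalizer (X : Set G)) :
    X ≤ L₁ ∨ X ⊔ L₁ = L := by
  have hc : ⁅L, U⁆ ≤ L₁ := by
    rcases hchief (⁅L, U⁆ ⊔ L₁) inferInstance le_sup_right
      (sup_le (commutator_le_left _ _) hL₁.le) with h | h
    · rw [← h]; exact le_sup_left
    · exact absurd (le_of_le_commutator_sup hLU h.ge) hL₁.not_ge
  have hn : (X ⊔ L₁).Normal := by
    rw [← normalizer_eq_top_iff, ← top_le_iff, ← hKU]
    refine sup_le ?_ ?_
    · exact hX.trans (normalizer_le_normalizer_sup_of_normalizer_le_left le_normalizer_of_normal)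
    · rw [le_normalizer_iff_commutator_le_right, commutator_comm]
      refine le_trans ?_ (hc.trans le_sup_right)
      exact commutator_mono (sup_le hXL hL₁.le) le_rfl
  rcases hchief _ hn le_sup_right (sup_le hXL hL₁.le) with h | h
  · left; rw [← h]; exact le_sup_left
  · exact Or.inr h

theorem InvariantChain.of_supplement [Finite G] {K U : Subgroup G} [U.Normal]
    [Group.IsNilpotent U] (hKU : K ⊔ U = ⊤) {m : ℕ} {L : Subgroup G} (hL : L.Normal) (hLU : L ≤ U)
    (h : InvariantChain K m L) : InvariantChain ⊤ m L := by
  induction hc : Nat.card L using Nat.strong_induction_on generalizing L m with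
  | _ c ih =>
    by_cases hbot : L = ⊥
    · subst hbot
      have := h.lt_card
      rw [card_bot] at this
      obtain rfl : m = 0 := by omega
      exact base le_normalizer_of_normal
    obtain ⟨L₁, hL₁⟩ := Set.Finite.exists_maximal
      (Set.toFinite {N : Subgroup G | N.Normal ∧ N < L})
      ⟨⊥, inferInstance, bot_lt_iff_ne_bot.2 hbot⟩
    obtain ⟨hn, hlt⟩ := hL₁.1
    obtain ⟨k, hk, hchain⟩ := h.inf (L := L) (L₁ := L₁) le_rfl fun X hXL hX =>
      le_or_sup_eq_of_nilpotent hKU hLU hlt (fun N hN h1 h2 => by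
        rcases h2.eq_or_lt with h | h
        · exact Or.inr h
        · exact Or.inl (le_antisymm (hL₁.2 ⟨hN, h⟩ h1) h1)) hXL hX
    rw [inf_eq_right.2 hlt.le] at hchain
    have hcard : Nat.card L₁ < c := hc ▸ Set.Finite.card_lt_card (Set.toFinite _) hlt
    have := ih _ hcard hn (hlt.le.trans hLU) hchain rfl
    exact (step this hlt le_normalizer_of_normal).mono_length hk

end InvariantChain

section

variable {G A : Type} [Group G] [Finite G] [Group A] {ι φ : A →* G} {p n : ℕ}

theorem map_eq_map_of_map_le (hι : Function.Injective ι) (hφ : Function.Injective φ)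
    {X : Subgroup A} (h : X.map φ ≤ X.map ι) : X.map φ = X.map ι :=
  eq_of_le_of_card_eq h (by rw [card_map_of_injective hφ, card_map_of_injective hι])

theorem index_range_eq (hι : Function.Injective ι) (hφ : Function.Injective φ) :
    φ.range.index = ι.range.index := by
  have h1 := ι.range.card_mul_index
  have h2 := φ.range.card_mul_index
  rw [card_range_of_injective hι] at h1
  rw [card_range_of_injective hφ, ← h1] at h2
  have : Finite A := Finite.of_injective ι hι
  exact mul_left_cancel₀ Nat.card_pos.ne' h2

theorem card_sup_mul_card_inf {G : Type*} [Group G] (L M : Subgroup G) [M.Normal] :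
    Nat.card (L ⊔ M : Subgroup G) * Nat.card (L ⊓ M : Subgroup G) = Nat.card L * Nat.card M := by
  have h1 := relIndex_sup_right L M
  have h2 := card_mul_index (M.subgroupOf (L ⊔ M))
  have h3 := card_mul_index (M.subgroupOf L)
  have e1 : Nat.card (M.subgroupOf (L ⊔ M)) = Nat.card M :=
    Nat.card_congr (subgroupOfEquivOfLe le_sup_right).toEquiv
  have e2 : Nat.card (M.subgroupOf L) = Nat.card (L ⊓ M : Subgroup G) := by
    rw [← inf_subgroupOf_left, Nat.card_congr (subgroupOfEquivOfLe inf_le_left).toEquiv]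
  rw [e1] at h2
  rw [e2] at h3
  change M.relIndex _ = M.relIndex _ at h1
  change _ * M.relIndex _ = _ at h2 h3
  rw [← h2, ← h3, h1]
  ring

theorem sup_eq_top_of_card (L M : Subgroup G) [M.Normal]
    (h : Nat.card G * Nat.card (L ⊓ M : Subgroup G) = Nat.card L * Nat.card M) : L ⊔ M = ⊤ := by
  rw [← card_sup_mul_card_inf] at h
  exact (eq_top_of_card_eq _ (mul_right_cancel₀ Nat.card_pos.ne' h).symm)

theorem isCoatom_range_of_pCore_ne_bot [Group.IsSolvable G] (hp : p.Prime)
    (IH : ∀ (N : Subgroup G) [N.Normal], N ≠ ⊥ → MaximalTransfer p n (G ⧸ N))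
    (hι : Function.Injective ι) (hφ : Function.Injective φ) (hH : IsCoatom ι.range)
    (hidx : ι.range.index = p ^ n) (hU : pCore p (⊤ : Subgroup G) ≠ ⊥) : IsCoatom φ.range := by
  have := Fact.mk hp
  set U := pCore p (⊤ : Subgroup G) with hUdef
  set D := pCore p (⊤ : Subgroup A) with hDdef
  have hidx' := (index_range_eq hι hφ).trans hidx
  have hUp : IsPGroup p U := isPGroup_pCore p _
  have hDle : ∀ f : A →* G, Function.Injective f → f.range.index = p ^ n →
      D.map f = f.range ⊓ U := by
    intro f hf hi
    rw [hDdef, map_pCore_top hf]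
    refine le_antisymm (le_inf (pCore_le _ _) (pCore_le_of_index hp hi)) ?_
    refine le_pCore inf_le_left (le_normalizer_inf_normal le_normalizer)
      (hUp.to_le inf_le_right)
  have hDι := hDle ι hι hidx
  have hDφ := hDle φ hφ hidx'
  by_cases hUH : U ≤ ι.range
  · rw [inf_eq_right.2 hUH] at hDι
    have h1 : D.map φ = D.map ι := map_eq_map_of_map_le hι hφ (by
      rw [hDι, hDφ]; exact inf_le_right)
    refine isCoatom_range_of_normal IH hι hφ hH hidx h1 ?_ (pCore_top_normal p)
    rintro h
    rw [h, Subgroup.map_bot] at hDι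
    exact hU hDι.symm
  have hHU : ι.range ⊔ U = ⊤ := by
    refine hH.2 _ (lt_of_le_of_ne le_sup_left fun h => hUH ?_)
    rw [h]; exact le_sup_right
  have hKU : φ.range ⊔ U = ⊤ := by
    apply sup_eq_top_of_card
    have h1 := card_sup_mul_card_inf ι.range U
    rw [hHU, card_top, ← hDι, card_map_of_injective hι, card_range_of_injective hι] at h1
    rw [← hDφ, card_map_of_injective hφ, card_range_of_injective hφ, h1]
  have hnil : Group.IsNilpotent U := hUp.isNilpotent
  have hDlt : D.map ι < U := by
    rw [hDι]
    exact lt_of_le_of_ne inf_le_right fun h => hUH (inf_eq_right.1 h)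
  have hDn : (D.map ι).Normal := by
    rw [← normalizer_eq_top_iff]
    have h1 : ι.range ≤ normalizer (D.map ι : Set G) := by
      rw [hDdef, map_pCore_top hι]; exact le_normalizer_pCore p _
    refine hH.2 _ (lt_of_le_of_ne h1 fun h => ?_)
    have hnc := Group.normalizerCondition_of_isNilpotent (G := U) ((D.map ι).subgroupOf U)
      (lt_top_iff_ne_top.2 fun h => hDlt.not_ge (subgroupOf_eq_top.1 h))
    rw [← subgroupOf_normalizer_eq hDlt.le, ← h] at hnc
    refine hnc.not_ge ?_
    rw [hDι, inf_subgroupOf_right]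
  by_contra hK
  have hKtop : φ.range ≠ ⊤ := by
    intro h
    rw [h, index_top, ← hidx, eq_comm, index_eq_one] at hidx'
    exact hH.1 hidx'
  obtain ⟨M, hKM, hMtop⟩ : ∃ M, φ.range < M ∧ M ≠ ⊤ := by
    by_contra! h
    exact hK ⟨hKtop, fun M hM => h M hM⟩
  have hinv : ∀ L : Subgroup G, φ.range ≤ L →
      φ.range ≤ normalizer ((L ⊓ U : Subgroup G) : Set G) :=
    fun L hL => le_normalizer_inf_normal (hL.trans le_normalizer)
  have hded : ∀ L : Subgroup G, φ.range ≤ L → φ.range ⊔ (L ⊓ U) = L := by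
    intro L hL
    refine le_antisymm (sup_le hL inf_le_left) fun x hx => ?_
    have hx' : x ∈ φ.range ⊔ U := by rw [hKU]; trivial
    obtain ⟨k, hk, u, hu, rfl⟩ := mem_sup_of_normal_right.1 hx'
    exact mul_mem_sup hk ⟨by simpa using mul_mem (inv_mem (hL hk)) hx, hu⟩
  have hlt1 : D.map φ < M ⊓ U := by
    rw [hDφ]
    refine lt_of_le_of_ne (inf_le_inf_right _ hKM.le) fun h => hKM.ne ?_
    rw [← hded M hKM.le, ← h, sup_inf_self]
  have hlt2 : M ⊓ U < U := by
    refine lt_of_le_of_ne inf_le_right fun h => hMtop ?_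
    rw [← hded M hKM.le, h, hKU]
  have hgrow : ∀ m, InvariantChain φ.range m (D.map φ) →
      InvariantChain φ.range (m + 1) (D.map φ) := by
    intro m hm
    have h1 := (hm.step hlt1 (hinv M hKM.le)).step hlt2 le_normalizer_of_normal
    obtain ⟨k, hk, hc⟩ := h1.inf (L := U) (L₁ := D.map ι) le_rfl fun X hXL hX =>
      le_or_sup_eq_of_nilpotent hKU le_rfl hDlt (fun N hN h1 h2 => by
        by_cases hNH : N ≤ ι.range
        · left
          refine le_antisymm ?_ h1
          rw [hDι]; exact le_inf hNH h2
        · right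
          refine le_antisymm h2 fun u hu => ?_
          have h3 : ι.range ⊔ N = ⊤ := by
            refine hH.2 _ (lt_of_le_of_ne le_sup_left fun h => hNH ?_)
            rw [h]; exact le_sup_right
          have hx' : u ∈ ι.range ⊔ N := by rw [h3]; trivial
          obtain ⟨k, hk, v, hv, rfl⟩ := mem_sup_of_normal_right.1 hx'
          refine mul_mem (h1 ?_) hv
          rw [hDι]
          exact ⟨hk, by simpa using mul_mem hu (inv_mem (h2 hv))⟩) hXL hX
    rw [inf_eq_right.2 hDlt.le] at hc
    have h2 := hc.of_supplement hKU hDn hDlt.le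
    have h3 := (h2.comap (map_le_range ι D)).mono_length (k := m + 1) (by omega)
    rw [comap_map_eq_self_of_injective hι, comap_top] at h3
    have h4 := h3.map hφ
    rwa [← MonoidHom.range_eq_map] at h4
  have hall : ∀ m, InvariantChain φ.range m (D.map φ) := by
    intro m
    induction m with
    | zero =>
      refine .base ?_
      rw [hDφ]
      exact hinv _ le_rfl
    | succ m ih => exact hgrow m ih
  exact absurd (hall _).lt_card (lt_irrefl _)

end

section CoprimeAction

theorem apply_prod_range_pow_apply {Q : Type*} [CommGroup Q] {c : Monoid.End Q} {s : ℕ}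
    (hc : c ^ s = 1) (q : Q) :
    c (∏ j ∈ Finset.range s, (c ^ j) q) = ∏ j ∈ Finset.range s, (c ^ j) q := by
  have h1 := Finset.prod_range_succ (fun j => (c ^ j) q) s
  have h2 := Finset.prod_range_succ' (fun j => (c ^ j) q) s
  rw [h1, hc, pow_zero] at h2
  rw [map_prod, mul_right_cancel h2]
  exact Finset.prod_congr rfl fun j _ => by rw [pow_succ']; rfl

/-- If commuting automorphisms `a`, `b` of exponent `s` act on an abelian group, then `s`-th powers
lie in any subgroup containing the fixed points of `a` and of all `a ^ i * b`. -/
theorem pow_mem_of_fixed_mem {Q : Type*} [CommGroup Q] {a b : Monoid.End Q} {s : ℕ}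
    (hs : s.Prime) (hab : Commute a b) (ha : a ^ s = 1) (hb : b ^ s = 1) {E : Subgroup Q}
    (h1 : ∀ q, a q = q → q ∈ E) (h2 : ∀ i : ℕ, ∀ q, (a ^ i * b) q = q → q ∈ E) (q : Q) :
    q ^ s ∈ E := by
  have hP : ∏ i ∈ Finset.range s, ∏ j ∈ Finset.range s, ((a ^ i * b) ^ j) q ∈ E := by
    refine prod_mem fun i _ => h2 i _ (apply_prod_range_pow_apply ?_ q)
    rw [(hab.pow_left i).mul_pow, ← pow_mul, mul_comm, pow_mul, ha, hb, one_pow, one_mul]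
  rw [Finset.prod_comm] at hP
  obtain ⟨k, rfl⟩ : ∃ k, s = k + 1 := ⟨s - 1, by have := hs.pos; omega⟩
  rw [Finset.prod_range_succ'] at hP
  simp only [pow_zero, Monoid.End.coe_one, id_eq, Finset.prod_const, Finset.card_range] at hP
  refine (Subgroup.mul_mem_cancel_left _ (prod_mem fun j hj => ?_)).1 hP
  have hcop : Nat.Coprime (j + 1) (k + 1) := by
    rw [Nat.coprime_comm, hs.coprime_iff_not_dvd]
    have := Finset.mem_range.1 hj
    exact Nat.not_dvd_of_pos_of_lt (by omega) (by omega)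
  have hfix := apply_prod_range_pow_apply (c := a ^ (j + 1)) (s := k + 1)
    (by rw [← pow_mul, mul_comm, pow_mul, ha, one_pow]) ((b ^ (j + 1)) q)
  have heq : ∏ i ∈ Finset.range (k + 1), ((a ^ i * b) ^ (j + 1)) q =
      ∏ i ∈ Finset.range (k + 1), ((a ^ (j + 1)) ^ i) ((b ^ (j + 1)) q) := by
    refine Finset.prod_congr rfl fun i _ => ?_
    rw [(hab.pow_left i).mul_pow, ← pow_mul, mul_comm i, pow_mul]
    rfl
  rw [heq]
  set P := ∏ i ∈ Finset.range (k + 1), ((a ^ (j + 1)) ^ i) ((b ^ (j + 1)) q)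
  apply h1
  obtain ⟨m, -, hm⟩ := Nat.exists_mul_mod_eq_one_of_coprime hcop hs.one_lt
  have h3 : ∀ m : ℕ, ((a ^ (j + 1)) ^ m) P = P := by
    intro m
    induction m with
    | zero => simp
    | succ m ih =>
      rw [pow_succ']
      change (a ^ (j + 1)) (((a ^ (j + 1)) ^ m) P) = P
      rw [ih, hfix]
  have h4 := h3 m
  rw [← pow_mul, ← Nat.mod_add_div ((j + 1) * m) (k + 1), hm, pow_add, pow_mul, ha, one_pow,
    mul_one, pow_one] at h4
  exact h4

variable {Γ : Type*} [Group Γ] [Finite Γ]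

theorem exists_fixed_mem_coset {s : ℕ} (hs : s.Prime) {g : Γ} (hg : g ^ s = 1) {D : Subgroup Γ}
    (hgD : g ∈ normalizer (D : Set Γ)) (hD : ¬ s ∣ Nat.card D) {d : Γ}
    (hd : d⁻¹ * (g * d * g⁻¹) ∈ D) : ∃ y, d⁻¹ * y ∈ D ∧ g * y * g⁻¹ = y := by
  classical
  have := Fact.mk hs
  have hpres : ∀ y, d⁻¹ * y ∈ D ↔ d⁻¹ * (MulAut.conj g y) ∈ D := by
    intro y
    have : d⁻¹ * MulAut.conj g y = d⁻¹ * (g * d * g⁻¹) * (g * (d⁻¹ * y) * g⁻¹) := by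
      rw [MulAut.conj_apply]; group
    rw [this, Subgroup.mul_mem_cancel_left _ hd, ← mem_normalizer_iff.1 hgD]
  let σ : Equiv.Perm {y // d⁻¹ * y ∈ D} :=
    Equiv.Perm.subtypePerm (MulAut.conj g).toEquiv fun y => (hpres y).symm
  have hσ : σ ^ s ^ 1 = 1 := by
    rw [pow_one]
    ext y
    have : ∀ m : ℕ, ((σ ^ m) y : Γ) = g ^ m * y * (g ^ m)⁻¹ := by
      intro m
      induction m with
      | zero => simp
      | succ m ih =>
        rw [pow_succ', Equiv.Perm.mul_apply]
        change g * ((σ ^ m) y : Γ) * g⁻¹ = _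
        rw [ih, pow_succ']; group
    rw [this, hg]; simp
  let e : {y // d⁻¹ * y ∈ D} ≃ D :=
    { toFun := fun y => ⟨d⁻¹ * y, y.2⟩
      invFun := fun y => ⟨d * y, by simp⟩
      left_inv := fun y => by simp
      right_inv := fun y => by simp }
  have : Fintype {y // d⁻¹ * y ∈ D} := Fintype.ofFinite _
  obtain ⟨y, hy⟩ := Equiv.Perm.exists_fixed_point_of_prime (p := s) (n := 1) (by
    rwa [← Nat.card_eq_fintype_card, Nat.card_congr e]) hσ
  exact ⟨y, y.2, congrArg Subtype.val hy⟩

theorem le_of_fixed_le_of_rank_two [Group.IsSolvable Γ] {s : ℕ} (hs : s.Prime) {x z : Γ}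
    (hxz : Commute x z) (hx : x ^ s = 1) (hz : z ^ s = 1) (D E : Subgroup Γ)
    (hxD : x ∈ normalizer (D : Set Γ)) (hzD : z ∈ normalizer (D : Set Γ))
    (hD : ¬ s ∣ Nat.card D) (h1 : ∀ d ∈ D, Commute x d → d ∈ E)
    (h2 : ∀ i : ℕ, ∀ d ∈ D, Commute (x ^ i * z) d → d ∈ E) : D ≤ E := by
  induction hc : Nat.card D using Nat.strong_induction_on generalizing D with
  | _ c ih =>
  by_cases hbot : D = ⊥
  · rw [hbot]; exact bot_le
  have hlt := Group.IsSolvable.commutator_lt_of_ne_bot hbot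
  have hnorm : ∀ g ∈ normalizer (D : Set Γ), g ∈ normalizer ((⁅D, D⁆ : Subgroup Γ) : Set Γ) := by
    intro g hg
    rw [mem_normalizer_iff_map_conj_eq] at hg ⊢
    rw [Subgroup.map_commutator, hg]
  have hcard : ¬ s ∣ Nat.card (⁅D, D⁆ : Subgroup Γ) := fun h =>
    hD (h.trans (card_dvd_of_le hlt.le))
  have hE : ⁅D, D⁆ ≤ E := ih _ (hc ▸ Set.Finite.card_lt_card (Set.toFinite _) hlt) _
    (hnorm x hxD) (hnorm z hzD) hcard (fun d hd => h1 d (hlt.le hd))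
    (fun i d hd => h2 i d (hlt.le hd)) rfl
  let F : normalizer (D : Set Γ) →* Monoid.End (Abelianization D) :=
    { toFun := fun g => Abelianization.map (D.normalizerMonoidHom g).toMonoidHom
      map_one' := by
        ext q
        obtain ⟨d, rfl⟩ := QuotientGroup.mk_surjective q
        change Abelianization.of (D.normalizerMonoidHom 1 d) = Abelianization.of d
        rw [map_one]
        rfl
      map_mul' := fun g h => by
        ext q
        obtain ⟨d, rfl⟩ := QuotientGroup.mk_surjective q
        change Abelianization.of (D.normalizerMonoidHom (g * h) d) = Abelianization.of _
        rw [map_mul]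
        rfl }
  have hF : ∀ g d, F g (Abelianization.of d) = Abelianization.of (D.normalizerMonoidHom g d) :=
    fun g d => rfl
  have hker : ∀ d e : D, Abelianization.of d = Abelianization.of e → (d : Γ)⁻¹ * e ∈ ⁅D, D⁆ := by
    intro d e h
    have h3 : d⁻¹ * e ∈ _root_.commutator D := by
      rw [← Abelianization.ker_of, MonoidHom.mem_ker, map_mul, map_inv, h, inv_mul_cancel]
    have := mem_map_of_mem D.subtype h3
    rwa [map_subtype_commutator] at this
  have hfix : ∀ g : normalizer (D : Set Γ), (g : Γ) ^ s = 1 →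
      (∀ d ∈ D, Commute (g : Γ) d → d ∈ E) → ∀ q, F g q = q →
        q ∈ (E.subgroupOf D).map Abelianization.of := by
    intro g hg hgE q hq
    obtain ⟨d, rfl⟩ := QuotientGroup.mk_surjective q
    change F g (Abelianization.of d) = Abelianization.of d at hq
    change Abelianization.of d ∈ _
    rw [hF] at hq
    obtain ⟨y, hy1, hy2⟩ := exists_fixed_mem_coset hs hg (hnorm g g.2) hcard (hker _ _ hq.symm)
    have hyD : y ∈ D := by
      have := mul_mem d.2 (hlt.le hy1)
      simpa using this
    have hyE : y ∈ E := hgE y hyD (by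
      rw [commute_iff_eq]; exact mul_inv_eq_iff_eq_mul.1 hy2)
    refine ⟨⟨y, hyD⟩, hyE, ?_⟩
    have h3 : d⁻¹ * ⟨y, hyD⟩ ∈ _root_.commutator D := by
      have : ((d⁻¹ * ⟨y, hyD⟩ : D) : Γ) ∈ (_root_.commutator D).map D.subtype := by
        rw [map_subtype_commutator]; exact hy1
      obtain ⟨u, hu, hu'⟩ := this
      rwa [← Subtype.ext hu']
    rw [← Abelianization.ker_of, MonoidHom.mem_ker, map_mul, map_inv] at h3
    exact (inv_mul_eq_one.1 h3).symm
  let x' : normalizer (D : Set Γ) := ⟨x, hxD⟩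
  let z' : normalizer (D : Set Γ) := ⟨z, hzD⟩
  have hxz' : Commute x' z' := Subtype.ext hxz
  have key := pow_mem_of_fixed_mem (a := F x') (b := F z') hs (hxz'.map F)
    (by rw [← map_pow, ← map_one F]; congr 1; exact Subtype.ext hx)
    (by rw [← map_pow, ← map_one F]; congr 1; exact Subtype.ext hz)
    (hfix x' hx h1) (fun i q hq => by
      rw [← map_pow, ← map_mul] at hq
      refine hfix (x' ^ i * z') ?_ (fun d hd h => h2 i d hd h) q hq
      change (x ^ i * z) ^ s = 1
      rw [(hxz.pow_left i).mul_pow, ← pow_mul, mul_comm, pow_mul, hx, hz, one_pow, one_mul])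
  intro d hd
  obtain ⟨e, heE, he⟩ := key (Abelianization.of ⟨d, hd⟩)
  have h3 : d ^ s ∈ E := by
    have := hker e (⟨d, hd⟩ ^ s) (by rw [he, map_pow])
    have h4 := mul_mem (mem_subgroupOf.1 heE) (hE this)
    simpa using h4
  have hcop : Nat.Coprime s (orderOf d) := by
    refine (hs.coprime_iff_not_dvd).2 fun h => hD (h.trans ?_)
    have := orderOf_dvd_natCard (⟨d, hd⟩ : D)
    rwa [Subgroup.orderOf_mk] at this
  obtain ⟨m, hm⟩ := exists_pow_eq_self_of_coprime hcop
  rw [← hm]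
  exact pow_mem h3 m

end CoprimeAction

section ModularRepresentation

variable {Γ V : Type*} [Group Γ] {s : ℕ} [AddCommGroup V] [Module (ZMod s) V]

/-- The vectors fixed by a subgroup under a linear action. -/
def fixedVectors (ρ : Γ →* Module.End (ZMod s) V) (N : Subgroup Γ) : Submodule (ZMod s) V where
  carrier := {w | ∀ m ∈ N, ρ m w = w}
  add_mem' := fun ha hb m hm => by rw [map_add, ha m hm, hb m hm]
  zero_mem' := fun m _ => map_zero _
  smul_mem' := fun c w hw m hm => by rw [map_smul, hw m hm]

variable {ρ : Γ →* Module.End (ZMod s) V}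

theorem apply_mul_apply (a b : Γ) (u : V) : ρ (a * b) u = ρ a (ρ b u) := by
  rw [map_mul]; rfl

theorem inv_apply_apply (a : Γ) (u : V) : ρ a⁻¹ (ρ a u) = u := by
  rw [← apply_mul_apply, inv_mul_cancel, map_one]; rfl

theorem apply_inv_apply (a : Γ) (u : V) : ρ a (ρ a⁻¹ u) = u := by
  rw [← apply_mul_apply, mul_inv_cancel, map_one]; rfl

theorem fixedVectors_anti {M N : Subgroup Γ} (h : M ≤ N) :
    fixedVectors ρ N ≤ fixedVectors ρ M :=
  fun _ hw m hm => hw m (h hm)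

variable [Fact s.Prime]

theorem exists_fixed_ne_zero [Finite V] {M : Subgroup Γ} (hM : IsPGroup s M)
    {R : Submodule (ZMod s) V} (hR : R ≠ ⊥) (h : ∀ m ∈ M, ∀ w ∈ R, ρ m w ∈ R) :
    ∃ w ∈ R, w ≠ 0 ∧ w ∈ fixedVectors ρ M := by
  let _ : MulAction M R :=
    { smul := fun m w => ⟨ρ m w, h m m.2 w w.2⟩
      one_smul := fun w => Subtype.ext (by
        change ρ ((1 : M) : Γ) w = w
        rw [coe_one, map_one]; rfl)
      mul_smul := fun a b w => Subtype.ext (apply_mul_apply (ρ := ρ) (a : Γ) b w) }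
  have := Fintype.ofFinite R
  have : Nontrivial R := (Submodule.nontrivial_iff_ne_bot).2 hR
  have hdvd : s ∣ Nat.card R := by
    rw [Nat.card_eq_fintype_card, Module.card_eq_pow_finrank (K := ZMod s), ZMod.card]
    exact dvd_pow_self _ Module.finrank_pos.ne'
  obtain ⟨b, hb, hb0⟩ := hM.exists_fixed_point_of_prime_dvd_card_of_fixed_point R hdvd
    (a := (0 : R)) fun m => Subtype.ext (map_zero (ρ m))
  exact ⟨b, b.2, fun h0 => hb0 (Subtype.ext h0.symm),
    fun m hm => congrArg Subtype.val (hb ⟨m, hm⟩)⟩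

theorem apply_eq_self_of_coprime {t : Γ} (ht : ¬ s ∣ orderOf t) {u : V}
    (h : ρ t (ρ t u - u) = ρ t u - u) : ρ t u = u := by
  have h1 := geom_sum_mul (ρ t) (orderOf t)
  rw [← map_pow, pow_orderOf_eq_one, map_one, sub_self] at h1
  have h2 := congrArg (fun f : Module.End (ZMod s) V => f u) h1
  change (∑ i ∈ Finset.range (orderOf t), ρ t ^ i) (ρ t u - u) = 0 at h2
  have h3 : ∀ i : ℕ, (ρ t ^ i) (ρ t u - u) = ρ t u - u := by
    intro i
    induction i with
    | zero => simp
    | succ i ih =>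
      rw [pow_succ']
      change ρ t ((ρ t ^ i) (ρ t u - u)) = _
      rw [ih, h]
  rw [LinearMap.sum_apply, Finset.sum_congr rfl fun i _ => h3 i, Finset.sum_const,
    Finset.card_range, ← Nat.cast_smul_eq_nsmul (ZMod s), smul_eq_zero,
    ZMod.natCast_eq_zero_iff, sub_eq_zero] at h2
  exact h2.resolve_left ht

/-- An element of order prime to `s` that commutes with an `s`-group `M` and fixes all vectors
fixed by `M` is trivial. -/
theorem eq_one_of_fixes_fixedVectors [Finite V] (hρ : Function.Injective ρ) {M : Subgroup Γ}
    (hM : IsPGroup s M) {t : Γ} (ht : ¬ s ∣ orderOf t) (hc : ∀ m ∈ M, Commute t m)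
    (hfix : ∀ w ∈ fixedVectors ρ M, ρ t w = w) : t = 1 := by
  apply hρ
  rw [map_one]
  by_contra hne
  have hR : (ρ t - 1).range ≠ ⊥ := fun h => hne (sub_eq_zero.1 (LinearMap.range_eq_bot.1 h))
  obtain ⟨w, ⟨u, rfl⟩, hw0, hw⟩ := exists_fixed_ne_zero (ρ := ρ) hM hR (by
    rintro m hm _ ⟨u, rfl⟩
    refine ⟨ρ m u, ?_⟩
    change ρ t (ρ m u) - ρ m u = ρ m (ρ t u - u)
    rw [map_sub, ← apply_mul_apply, ← apply_mul_apply, (hc m hm).eq])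
  exact hw0 (sub_eq_zero.2 (apply_eq_self_of_coprime ht (hfix _ hw)))

theorem mul_card_le_of_lt [Finite V] {A B : Submodule (ZMod s) V} (h : A < B) :
    s * Nat.card A ≤ Nat.card B := by
  have := Fintype.ofFinite A
  have := Fintype.ofFinite B
  rw [Nat.card_eq_fintype_card, Nat.card_eq_fintype_card,
    Module.card_eq_pow_finrank (K := ZMod s), Module.card_eq_pow_finrank (K := ZMod s) (V := B),
    ZMod.card, ← pow_succ']
  exact Nat.pow_le_pow_right (Fact.out : s.Prime).pos (Submodule.finrank_lt_finrank_of_lt h)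

theorem card_sup_zpowers_le {M : Subgroup Γ} {x : Γ} (hx : x ∈ normalizer (M : Set Γ)) :
    Nat.card (zpowers x ⊔ M : Subgroup Γ) ≤ orderOf x * Nat.card M := by
  have h := coe_mul_of_left_le_normalizer_right (zpowers x) M (by rwa [zpowers_le])
  have h2 := Set.natCard_mul_le (s := (zpowers x : Set Γ)) (t := (M : Set Γ))
  rw [← h] at h2
  rwa [← Nat.card_zpowers]

variable [Finite Γ]

theorem inf_centralizer_le_of_offender [Finite V] [Group.IsSolvable Γ]
    (hρ : Function.Injective ρ) {N : Subgroup Γ} (hcomm : ∀ a ∈ N, ∀ b ∈ N, Commute a b)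
    (hexp : ∀ a ∈ N, a ^ s = 1)
    (hfix : ∀ M < N, Nat.card N ≤ s * Nat.card M → fixedVectors ρ M ≤ fixedVectors ρ N)
    {Y : Subgroup Γ} [Y.Normal] (hY : ¬ s ∣ Nat.card Y) {M : Subgroup Γ} (hM : M < N) :
    Y ⊓ centralizer (M : Set Γ) ≤ centralizer (N : Set Γ) := by
  have hs : s.Prime := Fact.out
  induction hk : Nat.card N - Nat.card M using Nat.strong_induction_on generalizing M with
  | _ k ih =>
  by_cases hcard : Nat.card N ≤ s * Nat.card M
  · intro t ht
    rw [mem_centralizer_iff]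
    intro ν hν
    have htM : ∀ m ∈ M, Commute t m := fun m hm => (mem_centralizer_iff.1 ht.2 m hm).symm
    have hcY : t * (ν * t⁻¹ * ν⁻¹) ∈ Y :=
      mul_mem ht.1 (Normal.conj_mem inferInstance _ (inv_mem ht.1) _)
    have hMs : IsPGroup s M := fun m => ⟨1, Subtype.ext (by simpa using hexp m (hM.le m.2))⟩
    have h1 : t * (ν * t⁻¹ * ν⁻¹) = 1 := by
      refine eq_one_of_fixes_fixedVectors hρ hMs (fun h => hY (h.trans ?_)) ?_ ?_
      · have := orderOf_dvd_natCard (⟨_, hcY⟩ : Y)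
        rwa [Subgroup.orderOf_mk] at this
      · intro m hm
        have h1 := htM m hm
        have h2 := hcomm ν hν m (hM.le hm)
        exact h1.mul_left ((h2.mul_left h1.inv_left).mul_left h2.inv_left)
      · intro w hw
        have h2 := hfix M hM hcard hw
        have h3 : ρ t⁻¹ w ∈ fixedVectors ρ M := fun m hm => by
          rw [← apply_mul_apply, ← (htM m hm).inv_left.eq, apply_mul_apply, hw m hm]
        have h4 := hfix M hM hcard h3 ν hν
        rw [apply_mul_apply, apply_mul_apply, apply_mul_apply, h2 _ (inv_mem hν), h4,
          apply_inv_apply]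
    calc ν * t = (t * (ν * t⁻¹ * ν⁻¹))⁻¹ * (t * ν) := by group
      _ = t * ν := by rw [h1, inv_one, one_mul]
  · push Not at hcard
    obtain ⟨x, hxN, hxM⟩ := SetLike.exists_of_lt hM
    have hnorm : ∀ a ∈ N, a ∈ centralizer (M : Set Γ) := fun a ha =>
      mem_centralizer_iff.2 fun m hm => hcomm m (hM.le hm) a ha
    have hcard1 : ∀ a ∈ N, Nat.card (zpowers a ⊔ M : Subgroup Γ) ≤ s * Nat.card M := by
      intro a ha
      refine (card_sup_zpowers_le (centralizer_le_normalizer _ (hnorm a ha))).trans ?_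
      exact Nat.mul_le_mul_right _ (orderOf_le_of_pow_eq_one hs.pos (hexp a ha))
    have hlt : ∀ a ∈ N, zpowers a ⊔ M < N := by
      intro a ha
      refine lt_of_le_of_ne (sup_le (by rwa [zpowers_le]) hM.le) fun h => ?_
      have := hcard1 a ha
      rw [h] at this
      omega
    have hrec : ∀ a ∈ N, a ∉ M → ∀ d ∈ Y ⊓ centralizer (M : Set Γ), Commute a d →
        d ∈ centralizer (N : Set Γ) := by
      intro a ha haM d hd had
      have h1 : M < zpowers a ⊔ M :=
        lt_of_le_of_ne le_sup_right fun h =>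
          haM (h ▸ (le_sup_left (a := zpowers a) (b := M)) (mem_zpowers a))
      have h2 : Nat.card M < Nat.card (zpowers a ⊔ M : Subgroup Γ) :=
        Set.Finite.card_lt_card (Set.toFinite _) h1
      have h3 : Nat.card (zpowers a ⊔ M : Subgroup Γ) < Nat.card N :=
        Set.Finite.card_lt_card (Set.toFinite _) (hlt a ha)
      refine ih _ (by omega) (hlt a ha) rfl ⟨hd.1, ?_⟩
      have h4 : zpowers a ⊔ M ≤ centralizer ({d} : Set Γ) := by
        refine sup_le ?_ fun m hm => ?_
        · rw [zpowers_le, mem_centralizer_singleton_iff]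
          exact had.eq
        · rw [mem_centralizer_singleton_iff]
          exact mem_centralizer_iff.1 hd.2 m hm
      exact mem_centralizer_iff.2 fun m hm => mem_centralizer_singleton_iff.1 (h4 hm)
    obtain ⟨z, hzN, hz⟩ := SetLike.exists_of_lt (hlt x hxN)
    have hnD : ∀ a ∈ N, a ∈ normalizer ((Y ⊓ centralizer (M : Set Γ) : Subgroup Γ) : Set Γ) := by
      intro a ha
      rw [inf_comm]
      refine le_normalizer_inf_normal (K := zpowers a) ?_ (mem_zpowers a)
      rw [zpowers_le]
      exact le_normalizer (hnorm a ha)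
    refine le_of_fixed_le_of_rank_two hs (hcomm x hxN z hzN) (hexp x hxN) (hexp z hzN) _ _
      (hnD x hxN) (hnD z hzN) (fun h => hY (h.trans (card_dvd_of_le inf_le_left)))
      (hrec x hxN hxM) fun i => hrec _ (mul_mem (pow_mem hxN i) hzN) fun h => hz ?_
    have h5 : (x ^ i)⁻¹ * (x ^ i * z) ∈ zpowers x ⊔ M :=
      mul_mem (inv_mem (pow_mem ((le_sup_left (a := zpowers x) (b := M)) (mem_zpowers x)) i))
        ((le_sup_right (a := zpowers x) (b := M)) h)
    simpa using h5

/-- An elementary abelian `s`-subgroup `N` with `|V| ≤ |N| |C_V(N)|` in a solvable linear group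
without normal `s`-subgroups yields a transvection. -/
theorem exists_transvection_of_offender [Finite V] [Group.IsSolvable Γ]
    (hρ : Function.Injective ρ) (hΓ : pCore s (⊤ : Subgroup Γ) = ⊥) {N : Subgroup Γ} (hN : N ≠ ⊥)
    (hcomm : ∀ a ∈ N, ∀ b ∈ N, Commute a b) (hexp : ∀ a ∈ N, a ^ s = 1)
    (hcard : Nat.card V ≤ Nat.card N * Nat.card (fixedVectors ρ N)) :
    ∃ x : Γ, orderOf x = s ∧ Nat.card V ≤ s * Nat.card (fixedVectors ρ (zpowers x)) := by
  have hs : s.Prime := Fact.out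
  induction hk : Nat.card N using Nat.strong_induction_on generalizing N with
  | _ k ih =>
  by_cases hmin : ∃ M < N, M ≠ ⊥ ∧ Nat.card V ≤ Nat.card M * Nat.card (fixedVectors ρ M)
  · obtain ⟨M, hMN, hM, hMc⟩ := hmin
    exact ih _ (hk ▸ Set.Finite.card_lt_card (Set.toFinite _) hMN) hM
      (fun a ha b hb => hcomm a (hMN.le ha) b (hMN.le hb)) (fun a ha => hexp a (hMN.le ha)) hMc rfl
  push Not at hmin
  obtain ⟨x, hxN, hx1⟩ := (Subgroup.ne_bot_iff_exists_ne_one).1 hN |>.elim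
    fun a ha => (⟨a, a.2, fun h => ha (Subtype.ext h)⟩ : ∃ x ∈ N, x ≠ 1)
  have hxo : orderOf x = s := orderOf_eq_prime (hexp x hxN) hx1
  have hxle : zpowers x ≤ N := by rwa [zpowers_le]
  by_cases hNx : Nat.card N ≤ s
  · refine ⟨x, hxo, ?_⟩
    have : zpowers x = N := Subgroup.eq_of_le_of_card_ge hxle (by rwa [Nat.card_zpowers, hxo])
    rw [this]
    exact hcard.trans (Nat.mul_le_mul_right _ hNx)
  have hNs : IsPGroup s N := fun m => ⟨1, Subtype.ext (by simpa using hexp m m.2)⟩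
  refine absurd (le_bot_iff.1 (hΓ ▸ le_pCore_of_forall_le_centralizer hNs fun r hr => ?_)) hN
  by_cases hrs : r = s
  · subst hrs
    rw [hΓ]
    intro g _
    rw [mem_centralizer_iff]
    rintro _ rfl
    simp
  rw [Subgroup.le_centralizer_iff]
  have hY : ¬ s ∣ Nat.card (pCore r (⊤ : Subgroup Γ)) := by
    have := Fact.mk hr
    obtain ⟨j, hj⟩ := IsPGroup.iff_card.1 (isPGroup_pCore r (⊤ : Subgroup Γ))
    rw [hj]
    exact fun h => hrs ((Nat.prime_dvd_prime_iff_eq hs hr).1 (hs.dvd_of_dvd_pow h)).symm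
  have key := inf_centralizer_le_of_offender hρ hcomm hexp (fun M hM hMc => ?_) hY
    (bot_lt_iff_ne_bot.2 hN)
  · refine le_trans (le_inf le_rfl fun g _ => ?_) key
    rw [mem_centralizer_iff]
    rintro _ rfl
    simp
  · have hM0 : M ≠ ⊥ := by
      rintro rfl
      rw [Subgroup.card_bot, mul_one] at hMc
      exact hNx hMc
    by_contra hlt
    have h1 := mul_card_le_of_lt (lt_of_le_of_ne (fixedVectors_anti (ρ := ρ) hM.le)
      fun h => hlt h.ge)
    have h2 := hmin M hM hM0
    have h3 : Nat.card N * Nat.card (fixedVectors ρ N) ≤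
        Nat.card M * Nat.card (fixedVectors ρ M) :=
      calc _ ≤ (s * Nat.card M) * Nat.card (fixedVectors ρ N) := Nat.mul_le_mul_right _ hMc
        _ = Nat.card M * (s * Nat.card (fixedVectors ρ N)) := by ring
        _ ≤ _ := Nat.mul_le_mul_left _ h1
    omega

end ModularRepresentation

section Transvections

open scoped commutatorElement

variable {Γ V : Type*} [Group Γ] {s : ℕ} [Fact s.Prime] [AddCommGroup V] [Module (ZMod s) V]
  {ρ : Γ →* Module.End (ZMod s) V}

theorem exists_transvection_functional [Finite V] (hρ : Function.Injective ρ) {x : Γ}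
    (hx : orderOf x = s) (hcard : Nat.card V ≤ s * Nat.card (fixedVectors ρ (zpowers x))) :
    ∃ (α : V →ₗ[ZMod s] ZMod s) (v : V), (∀ u, ρ x u = u + α u • v) ∧ α v = 0 ∧ v ≠ 0 := by
  have hs : s.Prime := Fact.out
  set P := ρ x - 1 with hP
  have hker : fixedVectors ρ (zpowers x) ≤ P.ker := fun w hw =>
    sub_eq_zero.2 (hw x (mem_zpowers x))
  have hrange : Nat.card P.range ≤ s := by
    have h1 := Submodule.card_eq_card_quotient_mul_card P.ker
    rw [Nat.card_congr P.quotKerEquivRange.toEquiv] at h1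
    have h2 : Nat.card (fixedVectors ρ (zpowers x)) ≤ Nat.card P.ker :=
      Nat.card_mono (Set.toFinite _) hker
    have h3 : Nat.card P.ker * Nat.card P.range ≤ Nat.card P.ker * s := by
      rw [← h1, mul_comm _ s]
      exact hcard.trans (Nat.mul_le_mul_left _ h2)
    exact Nat.le_of_mul_le_mul_left h3 Nat.card_pos
  have hx1 : x ≠ 1 := fun h => hs.one_lt.ne (by rw [← hx, h, orderOf_one])
  obtain ⟨u₀, hu₀⟩ : ∃ u, P u ≠ 0 := by
    by_contra! h
    refine hx1 (hρ ?_)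
    rw [map_one]
    exact sub_eq_zero.1 (LinearMap.ext h)
  set v := P u₀ with hv
  have hspan : Submodule.span (ZMod s) {v} = P.range := by
    have hle : Submodule.span (ZMod s) {v} ≤ P.range := by
      rw [Submodule.span_singleton_le_iff_mem]
      exact ⟨u₀, rfl⟩
    refine SetLike.coe_injective (Set.eq_of_subset_of_ncard_le hle ?_ (Set.toFinite _))
    change Nat.card P.range ≤ Nat.card (Submodule.span (ZMod s) {v})
    rw [Nat.card_congr (LinearEquiv.coord (ZMod s) V v hu₀).toEquiv, Nat.card_zmod]
    exact hrange
  let α : V →ₗ[ZMod s] ZMod s := (LinearEquiv.coord (ZMod s) V v hu₀).toLinearMap ∘ₗ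
    P.codRestrict (Submodule.span (ZMod s) {v}) fun u => hspan ▸ ⟨u, rfl⟩
  have hα : ∀ u, ρ x u = u + α u • v := by
    intro u
    have h1 : α u • v = P u := LinearEquiv.coord_apply_smul (ZMod s) V v hu₀ _
    rw [h1]
    change ρ x u = u + (ρ x u - u)
    abel
  refine ⟨α, v, hα, ?_, hu₀⟩
  have h1 : ∀ k : ℕ, ρ (x ^ k) v = (1 + α v) ^ k • v := by
    intro k
    induction k with
    | zero => simp
    | succ k ih =>
      rw [pow_succ', apply_mul_apply, ih, map_smul, hα, pow_succ, mul_smul, add_smul, one_smul]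
  have h2 := h1 s
  rw [ZMod.pow_card, orderOf_dvd_iff_pow_eq_one.1 hx.dvd, map_one, add_smul, one_smul] at h2
  exact (smul_eq_zero.1 (left_eq_add.1 h2)).resolve_right hu₀

/-- `x` and `y` act as transvections generating a two-dimensional special linear group. -/
structure DualTransvections (ρ : Γ →* Module.End (ZMod s) V) (x y : Γ)
    (α β : V →ₗ[ZMod s] ZMod s) (v w : V) : Prop where
  left : ∀ u, ρ x u = u + α u • v
  right : ∀ u, ρ y u = u + β u • w
  left_self : α v = 0
  right_self : β w = 0
  left_right : α w = 1
  right_left : β v ≠ 0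

theorem exists_dualTransvections [Finite V] [Finite Γ] [Group.IsSolvable Γ]
    (hρ : Function.Injective ρ) (hΓ : pCore s (⊤ : Subgroup Γ) = ⊥) {x : Γ}
    (hx : orderOf x = s) (hcard : Nat.card V ≤ s * Nat.card (fixedVectors ρ (zpowers x))) :
    ∃ (x y : Γ) (α β : V →ₗ[ZMod s] ZMod s) (v w : V), DualTransvections ρ x y α β v w := by
  have hs : s.Prime := Fact.out
  obtain ⟨α, v, hα, hαv, hv⟩ := exists_transvection_functional hρ hx hcard
  have hx1 : x ≠ 1 := fun h => hs.one_lt.ne (by rw [← hx, h, orderOf_one])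
  have hxs : IsPGroup s (zpowers x) :=
    IsPGroup.of_card (n := 1) (by rw [Nat.card_zpowers, hx, pow_one])
  obtain ⟨r, hr, g, hg, hgx⟩ : ∃ r, r.Prime ∧ ∃ g ∈ pCore r (⊤ : Subgroup Γ), ¬ g * x = x * g := by
    by_contra! h
    have h1 := le_pCore_of_forall_le_centralizer hxs fun r hr => by
      rw [zpowers_le, mem_centralizer_iff]
      exact h r hr
    rw [hΓ, le_bot_iff, zpowers_eq_bot] at h1
    exact hx1 h1
  have hrs : r ≠ s := by
    rintro rfl
    rw [hΓ, mem_bot] at hg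
    exact hgx (by rw [hg, one_mul, mul_one])
  set y := g * x * g⁻¹ with hy
  set β := α ∘ₗ ρ g⁻¹ with hβ
  set w := ρ g v with hw
  have hyβ : ∀ u, ρ y u = u + β u • w := by
    intro u
    rw [hy, apply_mul_apply, apply_mul_apply, hα, map_add, map_smul, apply_inv_apply]
    rfl
  have hβw : β w = 0 := by
    change α (ρ g⁻¹ (ρ g v)) = 0
    rw [inv_apply_apply, hαv]
  have hxy : x⁻¹ * y ≠ 1 := by
    intro h
    have h1 : x = y := inv_mul_eq_one.1 h
    refine hgx ?_
    conv_rhs => rw [h1, hy]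
    group
  have hxα : ∀ u, ρ x⁻¹ u = u - α u • v := by
    intro u
    have h1 : ρ x (u - α u • v) = u := by
      rw [hα, map_sub, map_smul, hαv, smul_zero, sub_zero, sub_add_cancel]
    calc ρ x⁻¹ u = ρ x⁻¹ (ρ x (u - α u • v)) := by rw [h1]
      _ = _ := inv_apply_apply _ _
  have ht : ∀ u, ρ (x⁻¹ * y) u - u = β u • w - α u • v - (β u * α w) • v := by
    intro u
    rw [apply_mul_apply, hyβ, hxα, map_add, map_smul, add_smul, smul_eq_mul]
    abel
  have hto : ¬ s ∣ orderOf (x⁻¹ * y) := by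
    have hmem : x⁻¹ * y ∈ pCore r (⊤ : Subgroup Γ) := by
      have : x⁻¹ * y = x⁻¹ * g * x⁻¹⁻¹ * g⁻¹ := by rw [hy]; group
      rw [this]
      exact mul_mem (Normal.conj_mem inferInstance g hg _) (inv_mem hg)
    have h1 := orderOf_dvd_natCard (⟨_, hmem⟩ : pCore r (⊤ : Subgroup Γ))
    rw [Subgroup.orderOf_mk] at h1
    have := Fact.mk hr
    obtain ⟨j, hj⟩ := IsPGroup.iff_card.1 (isPGroup_pCore r (⊤ : Subgroup Γ))
    rw [hj] at h1
    exact fun h => hrs ((Nat.prime_dvd_prime_iff_eq hs hr).1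
      (hs.dvd_of_dvd_pow (h.trans h1))).symm
  have hunip : ¬ ∀ u, ρ (x⁻¹ * y) (ρ (x⁻¹ * y) (ρ (x⁻¹ * y) u - u) - (ρ (x⁻¹ * y) u - u)) =
      ρ (x⁻¹ * y) (ρ (x⁻¹ * y) u - u) - (ρ (x⁻¹ * y) u - u) := by
    intro h
    refine hxy (hρ ?_)
    rw [map_one]
    exact LinearMap.ext fun u => apply_eq_self_of_coprime hto (apply_eq_self_of_coprime hto (h u))
  have hαw : α w ≠ 0 := by
    intro h0
    refine hunip fun u => ?_
    rw [← sub_eq_zero, ht, ht, ht]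
    simp [h0, hαv, hβw]
  have hβv : β v ≠ 0 := by
    intro h0
    refine hunip fun u => ?_
    rw [← sub_eq_zero, ht, ht, ht]
    simp [h0, hαv, hβw]
  refine ⟨x, y, α, α w • β, v, (α w)⁻¹ • w, hα, fun u => ?_, hαv, ?_, ?_, ?_⟩
  · rw [hyβ, LinearMap.smul_apply, smul_smul, smul_eq_mul, mul_right_comm, mul_inv_cancel₀ hαw,
      one_mul]
  · simp [hβw]
  · simp [hαw]
  · simp [hαw, hβv]

namespace DualTransvections

variable {x y : Γ} {α β : V →ₗ[ZMod s] ZMod s} {v w : V}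

theorem pow_left (h : DualTransvections ρ x y α β v w) (k : ℕ) (u : V) :
    ρ (x ^ k) u = u + (k * α u) • v := by
  induction k with
  | zero => simp
  | succ k ih =>
    rw [pow_succ', apply_mul_apply, ih, h.left, map_add, map_smul, h.left_self]
    push_cast
    module

theorem pow_right (h : DualTransvections ρ x y α β v w) (k : ℕ) (u : V) :
    ρ (y ^ k) u = u + (k * β u) • w := by
  induction k with
  | zero => simp
  | succ k ih =>
    rw [pow_succ', apply_mul_apply, ih, h.right, map_add, map_smul, h.right_self]
    push_cast
    module

theorem pow_left_eq_one (h : DualTransvections ρ x y α β v w) (hρ : Function.Injective ρ) :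
    x ^ s = 1 := by
  apply hρ
  ext u
  rw [h.pow_left]
  simp

theorem pow_right_eq_one (h : DualTransvections ρ x y α β v w) (hρ : Function.Injective ρ) :
    y ^ s = 1 := by
  apply hρ
  ext u
  rw [h.pow_right]
  simp

theorem left_ne_one (h : DualTransvections ρ x y α β v w) : x ≠ 1 := by
  rintro rfl
  have h1 := h.left w
  rw [map_one, h.left_right, one_smul] at h1
  exact h.right_left (by rw [left_eq_add.1 h1, map_zero])

theorem not_isSolvable (h : DualTransvections ρ x y α β v w) (hρ : Function.Injective ρ)
    (h2 : s ≠ 2) (h3 : s ≠ 3) : ¬ Group.IsSolvable Γ := by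
  intro hΓ
  have hs : s.Prime := Fact.out
  have h2' : (2 : ZMod s) ≠ 0 := fun h0 => h2
    ((Nat.prime_dvd_prime_iff_eq hs Nat.prime_two).1
      ((ZMod.natCast_eq_zero_iff 2 s).1 (mod_cast h0)))
  obtain ⟨a, ha⟩ : ∃ a : ZMod s, a * β v = 1 := ⟨_, inv_mul_cancel₀ h.right_left⟩
  obtain ⟨b, hb⟩ : ∃ b : ZMod s, 2 * b = 1 := ⟨_, mul_inv_cancel₀ h2'⟩
  have hcast : ∀ c : ZMod s, ∃ j : ℕ, (j : ZMod s) = c := fun c => ⟨c.val, ZMod.natCast_zmod_val c⟩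
  obtain ⟨j, hj⟩ := hcast a
  obtain ⟨i, hi⟩ := hcast (-(b * a))
  obtain ⟨k, hk⟩ := hcast (-2)
  obtain ⟨d, hd⟩ : ∃ d, d = x ^ k * (y ^ i * (x * y ^ j)) := ⟨_, rfl⟩
  have hdu : ∀ u, ρ d u = u + (a * β u) • v - (b * α u) • w := by
    intro u
    rw [hd, apply_mul_apply, apply_mul_apply, apply_mul_apply, h.pow_left, h.pow_right, h.left,
      h.pow_right, hi, hj, hk]
    simp only [map_add, map_smul, smul_eq_mul, h.left_self, h.right_self, h.left_right]
    linear_combination (norm := module) ((-b * β u * a - b * α u) * ha - β u * a * hb) • w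
      + ((2 * (a * β u) * b + 2 * b * α u) * ha + α u * hb + 2 * a * β u * hb) • v
  have hdx : d * x = x ^ 4 * d := by
    apply hρ
    ext u
    rw [apply_mul_apply, apply_mul_apply, h.left, hdu, h.pow_left, hdu]
    simp only [map_add, map_sub, map_smul, smul_eq_mul, h.left_self, h.left_right]
    push_cast
    linear_combination (norm := module) (α u * ha + 2 * α u * hb) • v
  have hdy : d * y ^ 4 = y * d := by
    apply hρ
    ext u
    rw [apply_mul_apply, apply_mul_apply, h.right, hdu, h.pow_right, hdu]
    simp only [map_add, map_sub, map_smul, smul_eq_mul, h.right_self, h.left_right]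
    push_cast
    linear_combination (norm := module) (-β u * ha - 2 * β u * hb) • w
  set X := closure {x, y} with hX
  have hxX : x ∈ X := subset_closure (by simp)
  have hyX : y ∈ X := subset_closure (by simp)
  have hdX : d ∈ X := hd ▸ mul_mem (pow_mem hxX _) (mul_mem (pow_mem hyX _)
    (mul_mem hxX (pow_mem hyX _)))
  have hcop : Nat.Coprime 3 s := (Nat.coprime_primes Nat.prime_three hs).2 h3.symm
  have hmem : ∀ g : Γ, g ^ s = 1 → g ^ 3 ∈ ⁅X, X⁆ → g ∈ ⁅X, X⁆ := by
    intro g hg hg3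
    obtain ⟨m, hm⟩ := exists_pow_eq_self_of_coprime
      (hcop.coprime_dvd_right (orderOf_dvd_of_pow_eq_one hg))
    rw [← hm]
    exact pow_mem hg3 m
  have hle : X ≤ ⁅X, X⁆ := by
    rw [hX, closure_le, ← hX]
    rintro g (rfl | rfl)
    · refine hmem _ (h.pow_left_eq_one hρ) ?_
      have : ⁅d, g⁆ = g ^ 3 := by
        rw [commutatorElement_def, hdx]; group
      rw [← this]
      exact commutator_mem_commutator hdX hxX
    · refine hmem _ (h.pow_right_eq_one hρ) ?_
      have : ⁅d, g ^ 4⁆ = (g ^ 3)⁻¹ := by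
        rw [commutatorElement_def, hdy]; group
      rw [← inv_mem_iff, ← this]
      exact commutator_mem_commutator hdX (pow_mem hyX 4)
  have hXbot : X ≠ ⊥ := fun h0 => h.left_ne_one (by rwa [h0, mem_bot] at hxX)
  exact (Group.IsSolvable.commutator_lt_of_ne_bot hXbot).not_ge hle

theorem linear_injective (h : DualTransvections ρ x y α β v w) :
    Function.Injective fun c : ZMod s × ZMod s => c.1 • v + c.2 • w := by
  rintro ⟨a, b⟩ ⟨a', b'⟩ hab
  have h1 := congrArg α hab
  have h2 := congrArg β hab
  simp only [map_add, map_smul, smul_eq_mul, h.left_self, h.right_self, h.left_right, mul_zero,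
    mul_one, zero_add, add_zero] at h1 h2
  rw [h1, mul_right_cancel₀ h.right_left h2]

/-- The group generated by a dual pair of transvections is transitive on the nonzero vectors of
the plane they act on. -/
theorem sq_sub_one_dvd_card [Finite Γ] (h : DualTransvections ρ x y α β v w) :
    s ^ 2 - 1 ∣ Nat.card (closure {x, y} : Subgroup Γ) := by
  have hs : s.Prime := Fact.out
  set X := closure {x, y} with hX
  have hxX : x ∈ X := subset_closure (by simp)
  have hyX : y ∈ X := subset_closure (by simp)
  let _ : MulAction X V :=
    { smul := fun g u => ρ g u
      one_smul := fun u => by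
        change ρ ((1 : X) : Γ) u = u
        rw [coe_one, map_one]; rfl
      mul_smul := fun a b u => apply_mul_apply (ρ := ρ) (a : Γ) b u }
  set f := fun c : ZMod s × ZMod s => c.1 • v + c.2 • w with hf
  have hO : MulAction.orbit X v = f '' {0}ᶜ := by
    apply Set.Subset.antisymm
    · have hinv : ∀ g ∈ X, ∀ c : ZMod s × ZMod s, ∃ c', ρ g (f c) = f c' := by
        intro g hg
        induction hg using closure_induction with
        | mem g hg =>
          rcases hg with rfl | rfl
          · intro c
            refine ⟨(c.1 + c.2, c.2), ?_⟩
            rw [h.left]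
            simp only [hf, map_add, map_smul, smul_eq_mul, h.left_self, h.left_right]
            module
          · intro c
            refine ⟨(c.1, c.2 + c.1 * β v), ?_⟩
            rw [h.right]
            simp only [hf, map_add, map_smul, smul_eq_mul, h.right_self]
            module
        | one => exact fun c => ⟨c, by rw [map_one]; rfl⟩
        | mul g g' _ _ h1 h2 =>
          intro c
          obtain ⟨c', hc'⟩ := h2 c
          obtain ⟨c'', hc''⟩ := h1 c'
          exact ⟨c'', by rw [apply_mul_apply, hc', hc'']⟩
        | inv g _ h1 =>
          intro c
          have hinj : Function.Injective fun c => (h1 c).choose := by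
            intro c c' hcc
            have e1 := (h1 c).choose_spec
            have e2 := (h1 c').choose_spec
            dsimp only at hcc
            rw [hcc, ← e2] at e1
            have e3 := congrArg (ρ g⁻¹) e1
            rw [inv_apply_apply, inv_apply_apply] at e3
            exact h.linear_injective e3
          obtain ⟨c', hc'⟩ := (Finite.injective_iff_surjective.1 hinj) c
          refine ⟨c', ?_⟩
          have e1 := (h1 c').choose_spec
          dsimp only at hc'
          rw [← hc', ← e1, inv_apply_apply]
      rintro _ ⟨g, rfl⟩
      obtain ⟨c, hc⟩ := hinv g g.2 (1, 0)
      have hv1 : f (1, 0) = v := by simp [hf]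
      refine ⟨c, fun h0 => ?_, ?_⟩
      · rw [Set.mem_singleton_iff.1 h0, hv1] at hc
        have h0' : f 0 = 0 := by simp [hf]
        have e3 := congrArg (ρ (g : Γ)⁻¹) hc
        rw [inv_apply_apply, h0', map_zero] at e3
        exact h.right_left (by rw [e3, map_zero])
      · rw [← hc, hv1]; rfl
    · have hstepx : ∀ a a' b : ZMod s, b ≠ 0 → f (a, b) ∈ MulAction.orbit X v →
          f (a', b) ∈ MulAction.orbit X v := by
        rintro a a' b hb ⟨g, hg⟩
        refine ⟨⟨x, hxX⟩ ^ ((a' - a) / b).val * g, ?_⟩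
        change ρ (x ^ _ * g) v = _
        change ρ g v = _ at hg
        rw [apply_mul_apply, hg, h.pow_left, ZMod.natCast_zmod_val]
        simp only [hf, map_add, map_smul, smul_eq_mul, h.left_self, h.left_right]
        have : (a' - a) / b * b = a' - a := div_mul_cancel₀ _ hb
        linear_combination (norm := module) this • v
      have hstepy : ∀ a b b' : ZMod s, a ≠ 0 → f (a, b) ∈ MulAction.orbit X v →
          f (a, b') ∈ MulAction.orbit X v := by
        rintro a b b' ha ⟨g, hg⟩
        refine ⟨⟨y, hyX⟩ ^ ((b' - b) / (a * β v)).val * g, ?_⟩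
        change ρ (y ^ _ * g) v = _
        change ρ g v = _ at hg
        rw [apply_mul_apply, hg, h.pow_right, ZMod.natCast_zmod_val]
        simp only [hf, map_add, map_smul, smul_eq_mul, h.right_self]
        have : (b' - b) / (a * β v) * (a * β v) = b' - b :=
          div_mul_cancel₀ _ (mul_ne_zero ha h.right_left)
        linear_combination (norm := module) this • w
      have h10 : f (1, 0) ∈ MulAction.orbit X v := by
        have : f (1, 0) = v := by simp [hf]
        rw [this]
        exact MulAction.mem_orbit_self v
      rintro _ ⟨⟨a, b⟩, hab, rfl⟩
      by_cases hb : b = 0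
      · have ha : a ≠ 0 := fun ha => hab (by rw [ha, hb]; rfl)
        exact hstepy a 1 b ha (hstepx 1 a 1 one_ne_zero (hstepy 1 0 1 one_ne_zero h10))
      · exact hstepx 1 a b hb (hstepy 1 0 b one_ne_zero h10)
  have h1 := MulAction.index_stabilizer X v
  rw [hO, Set.ncard_image_of_injective _ h.linear_injective, Set.ncard_compl, Set.ncard_singleton,
    Nat.card_prod, Nat.card_zmod, ← sq] at h1
  rw [← h1]
  exact index_dvd_card _

end DualTransvections

end Transvections

section CharacteristicSubgroups

variable {G A : Type*} [Group G] [Group A]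

/-- A subgroup that is abelian of exponent dividing `s`. -/
def IsElementary (s : ℕ) (N : Subgroup G) : Prop :=
  (∀ a ∈ N, ∀ b ∈ N, Commute a b) ∧ ∀ a ∈ N, a ^ s = 1

theorem IsElementary.mono {s : ℕ} {M N : Subgroup G} (hN : IsElementary s N) (h : M ≤ N) :
    IsElementary s M :=
  ⟨fun a ha b hb => hN.1 a (h ha) b (h hb), fun a ha => hN.2 a (h ha)⟩

theorem IsElementary.map {s : ℕ} {N : Subgroup A} (hN : IsElementary s N) (f : A →* G) :
    IsElementary s (N.map f) := by
  constructor
  · rintro _ ⟨a, ha, rfl⟩ _ ⟨b, hb, rfl⟩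
    exact (hN.1 a ha b hb).map f
  · rintro _ ⟨a, ha, rfl⟩
    rw [← map_pow, hN.2 a ha, map_one]

theorem IsElementary.comap {s : ℕ} {N : Subgroup G} (hN : IsElementary s N) {f : A →* G}
    (hf : Function.Injective f) : IsElementary s (N.comap f) := by
  refine ⟨fun a ha b hb => hf ?_, fun a ha => hf ?_⟩
  · rw [map_mul, map_mul, (hN.1 _ ha _ hb).eq]
  · rw [map_pow, hN.2 _ ha, map_one]

theorem IsElementary.isPGroup {s : ℕ} {N : Subgroup G} (hN : IsElementary s N) : IsPGroup s N :=
  fun m => ⟨1, Subtype.ext (by simpa using hN.2 m m.2)⟩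

theorem IsElementary.sup {s : ℕ} {M N : Subgroup G} (hM : IsElementary s M)
    (hN : IsElementary s N) (h : ∀ a ∈ M, ∀ b ∈ N, Commute a b) : IsElementary s (M ⊔ N) := by
  have hle : M ≤ normalizer (N : Set G) :=
    le_trans (fun a ha => mem_centralizer_iff.2 fun b hb => (h a ha b hb).eq.symm)
      (centralizer_le_normalizer _)
  have key : ∀ g ∈ M ⊔ N, ∃ a ∈ M, ∃ b ∈ N, g = a * b := by
    intro g hg
    rw [← SetLike.mem_coe, coe_mul_of_left_le_normalizer_right _ _ hle] at hg
    obtain ⟨a, ha, b, hb, rfl⟩ := hg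
    exact ⟨a, ha, b, hb, rfl⟩
  constructor
  · intro g hg g' hg'
    obtain ⟨a, ha, b, hb, rfl⟩ := key g hg
    obtain ⟨a', ha', b', hb', rfl⟩ := key g' hg'
    exact ((hM.1 a ha a' ha').mul_right (h a ha b' hb')).mul_left
      ((h a' ha' b hb).symm.mul_right (hN.1 b hb b' hb'))
  · intro g hg
    obtain ⟨a, ha, b, hb, rfl⟩ := key g hg
    rw [(h a ha b hb).mul_pow, hM.2 a ha, hN.2 b hb, one_mul]

/-- The elements of exponent `s` in the centre of a subgroup. -/
def omegaCenter (s : ℕ) (P : Subgroup G) : Subgroup G where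
  carrier := {z | z ∈ P ∧ (∀ y ∈ P, Commute y z) ∧ z ^ s = 1}
  mul_mem' := fun {a b} ha hb => ⟨mul_mem ha.1 hb.1,
    fun y hy => (ha.2.1 y hy).mul_right (hb.2.1 y hy),
    by rw [(hb.2.1 a ha.1).mul_pow, ha.2.2, hb.2.2, one_mul]⟩
  one_mem' := ⟨one_mem P, fun y _ => Commute.one_right y, one_pow s⟩
  inv_mem' := fun {a} ha => ⟨inv_mem ha.1, fun y hy => (ha.2.1 y hy).inv_right,
    by rw [inv_pow, ha.2.2, inv_one]⟩

theorem omegaCenter_le (s : ℕ) (P : Subgroup G) : omegaCenter s P ≤ P := fun _ h => h.1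

theorem isElementary_omegaCenter (s : ℕ) (P : Subgroup G) : IsElementary s (omegaCenter s P) :=
  ⟨fun _ ha _ hb => hb.2.1 _ ha.1, fun _ ha => ha.2.2⟩

theorem map_omegaCenter {f : A →* G} (hf : Function.Injective f) (s : ℕ) (P : Subgroup A) :
    (omegaCenter s P).map f = omegaCenter s (P.map f) := by
  ext g
  constructor
  · rintro ⟨z, hz, rfl⟩
    refine ⟨mem_map_of_mem f hz.1, ?_, by rw [← map_pow, hz.2.2, map_one]⟩
    rintro _ ⟨y, hy, rfl⟩
    exact (hz.2.1 y hy).map f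
  · rintro ⟨⟨z, hz, rfl⟩, h1, h2⟩
    refine ⟨z, ⟨hz, fun y hy => hf ?_, hf ?_⟩, rfl⟩
    · rw [map_mul, map_mul, (h1 _ (mem_map_of_mem f hy)).eq]
    · rw [map_pow, h2, map_one]

theorem le_normalizer_of_map_conj {P X : Subgroup G}
    (h : ∀ g ∈ P, X.map (MulAut.conj g).toMonoidHom = X) : P ≤ normalizer (X : Set G) :=
  fun g hg => mem_normalizer_iff_map_conj_eq.2 (h g hg)

theorem map_conj_eq_of_mem_normalizer {X : Subgroup G} {g : G} (h : g ∈ normalizer (X : Set G)) :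
    X.map (MulAut.conj g).toMonoidHom = X :=
  mem_normalizer_iff_map_conj_eq.1 h

theorem normalizer_le_normalizer_omegaCenter (s : ℕ) (P : Subgroup G) :
    normalizer (P : Set G) ≤ normalizer (omegaCenter s P : Set G) :=
  le_normalizer_of_map_conj fun g hg => by
    rw [map_omegaCenter (f := (MulAut.conj g).toMonoidHom) (MulAut.conj g).injective,
      map_conj_eq_of_mem_normalizer hg]

theorem normal_omegaCenter (s : ℕ) (P : Subgroup G) [P.Normal] : (omegaCenter s P).Normal :=
  normalizer_eq_top_iff.1 (top_le_iff.1
    (normalizer_eq_top (H := P) ▸ normalizer_le_normalizer_omegaCenter s P))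

theorem omegaCenter_ne_bot [Finite G] {s : ℕ} [Fact s.Prime] {P : Subgroup G} (hP : IsPGroup s P)
    (h : P ≠ ⊥) : omegaCenter s P ≠ ⊥ := by
  have : Nontrivial P := (nontrivial_iff_ne_bot P).2 h
  have hc := hP.bot_lt_center
  have hcs : IsPGroup s (center P) := hP.to_subgroup _
  have : Nontrivial (center P) := (nontrivial_iff_ne_bot _).2 hc.ne'
  obtain ⟨k, hk0, hk⟩ := hcs.nontrivial_iff_card.1 this
  obtain ⟨z, hz⟩ := exists_prime_orderOf_dvd_card' (G := center P) s
    (by rw [hk]; exact dvd_pow_self s hk0.ne')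
  have hz1 : z ≠ 1 := by
    rintro rfl
    rw [orderOf_one] at hz
    exact (Fact.out : s.Prime).one_lt.ne hz
  intro h0
  have hmem : ((z : P) : G) ∈ omegaCenter s P := by
    refine ⟨(z : P).2, fun y hy => ?_, ?_⟩
    · exact congrArg Subtype.val (mem_center_iff.1 z.2 ⟨y, hy⟩)
    · have := orderOf_dvd_iff_pow_eq_one.1 hz.dvd
      simpa using congrArg (fun u : center P => ((u : P) : G)) this
  rw [h0, mem_bot] at hmem
  exact hz1 (Subtype.ext (Subtype.ext hmem))

/-- `N` is an elementary abelian subgroup of `P` of maximal order. -/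
def IsMaxElementary (s : ℕ) (P N : Subgroup G) : Prop :=
  (N ≤ P ∧ IsElementary s N) ∧ ∀ M ≤ P, IsElementary s M → Nat.card M ≤ Nat.card N

/-- The Thompson subgroup, generated by the elementary abelian subgroups of maximal order. -/
def thompsonSubgroup (s : ℕ) (P : Subgroup G) : Subgroup G :=
  sSup {N | IsMaxElementary s P N}

theorem IsMaxElementary.map {s : ℕ} {P N : Subgroup A} (h : IsMaxElementary s P N) {f : A →* G}
    (hf : Function.Injective f) : IsMaxElementary s (P.map f) (N.map f) := by
  refine ⟨⟨map_mono h.1.1, h.1.2.map f⟩, fun M hM hMe => ?_⟩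
  rw [← map_comap_eq_self (hM.trans (map_le_range f P)), card_map_of_injective hf,
    card_map_of_injective hf]
  refine h.2 _ ?_ (hMe.comap hf)
  rw [← comap_map_eq_self_of_injective hf P]
  exact comap_mono hM

theorem IsMaxElementary.comap {s : ℕ} {P : Subgroup A} {N : Subgroup G} {f : A →* G}
    (h : IsMaxElementary s (P.map f) N) (hf : Function.Injective f) :
    IsMaxElementary s P (N.comap f) := by
  refine ⟨⟨?_, h.1.2.comap hf⟩, fun M hM hMe => ?_⟩
  · rw [← comap_map_eq_self_of_injective hf P]
    exact comap_mono h.1.1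
  · rw [← card_map_of_injective hf, ← card_map_of_injective (K := N.comap f) hf,
      map_comap_eq_self (h.1.1.trans (map_le_range f P))]
    exact h.2 _ (map_mono hM) (hMe.map f)

theorem map_thompsonSubgroup {f : A →* G} (hf : Function.Injective f) (s : ℕ) (P : Subgroup A) :
    (thompsonSubgroup s P).map f = thompsonSubgroup s (P.map f) := by
  apply le_antisymm
  · rw [map_le_iff_le_comap]
    exact sSup_le fun N hN => map_le_iff_le_comap.1 (le_sSup (hN.map hf))
  · refine sSup_le fun N hN => ?_
    rw [← map_comap_eq_self (hN.1.1.trans (map_le_range f P))]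
    exact map_mono (le_sSup (hN.comap hf))

theorem normalizer_le_normalizer_thompsonSubgroup (s : ℕ) (P : Subgroup G) :
    normalizer (P : Set G) ≤ normalizer (thompsonSubgroup s P : Set G) :=
  le_normalizer_of_map_conj fun g hg => by
    rw [map_thompsonSubgroup (f := (MulAut.conj g).toMonoidHom) (MulAut.conj g).injective,
      map_conj_eq_of_mem_normalizer hg]

theorem exists_isMaxElementary [Finite G] (s : ℕ) (P : Subgroup G) :
    ∃ N, IsMaxElementary s P N := by
  obtain ⟨N, hN, hmax⟩ := Set.exists_max_image {N : Subgroup G | N ≤ P ∧ IsElementary s N}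
    (fun N => Nat.card N) (Set.toFinite _)
    ⟨⊥, bot_le, by rintro _ rfl _ rfl; rfl, by rintro _ rfl; exact one_pow s⟩
  exact ⟨N, hN, fun M hM hMe => hmax M ⟨hM, hMe⟩⟩

theorem thompsonSubgroup_ne_bot [Finite G] {s : ℕ} [Fact s.Prime] {P : Subgroup G}
    (hP : IsPGroup s P) (h : P ≠ ⊥) : thompsonSubgroup s P ≠ ⊥ := by
  obtain ⟨N, hN⟩ := exists_isMaxElementary s P
  intro h0
  have hN0 : N = ⊥ := le_bot_iff.1 (h0 ▸ le_sSup hN)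
  have h1 := hN.2 _ (omegaCenter_le s P) (isElementary_omegaCenter s P)
  rw [hN0, Subgroup.card_bot] at h1
  exact omegaCenter_ne_bot hP h (eq_bot_of_card_le _ h1)

theorem thompsonSubgroup_inf {s : ℕ} {P C : Subgroup G}
    (h : ∀ N, IsMaxElementary s P N → N ≤ C) [Finite G] :
    thompsonSubgroup s (P ⊓ C) = thompsonSubgroup s P := by
  have key : ∀ N, IsMaxElementary s P N → IsMaxElementary s (P ⊓ C) N := fun N hN =>
    ⟨⟨le_inf hN.1.1 (h N hN), hN.1.2⟩, fun M hM => hN.2 M (hM.trans inf_le_left)⟩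
  apply le_antisymm
  · refine sSup_le fun N hN => le_sSup ⟨⟨hN.1.1.trans inf_le_left, hN.1.2⟩, fun M hM hMe => ?_⟩
    obtain ⟨N', hN'⟩ := exists_isMaxElementary s P
    exact (hN'.2 M hM hMe).trans (hN.2 N' (key N' hN').1.1 hN'.1.2)
  · exact sSup_le fun N hN => le_sSup (key N hN)

theorem exists_sylow_map_eq_inf [Finite G] {s : ℕ} [Fact s.Prime] (P : Sylow s G)
    (C : Subgroup G) [C.Normal] :
    ∃ Q : Sylow s C, (Q : Subgroup C).map C.subtype = (P : Subgroup G) ⊓ C := by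
  obtain ⟨Q, hQ⟩ := IsPGroup.exists_le_sylow (P.isPGroup'.comap_subtype (K := C))
  obtain ⟨P', hP'⟩ := IsPGroup.exists_le_sylow (Q.isPGroup'.map C.subtype)
  obtain ⟨g, hg⟩ := MulAction.exists_smul_eq G P P'
  have h1 : (P : Subgroup G) ⊓ C ≤ (Q : Subgroup C).map C.subtype := by
    rw [← subgroupOf_map_subtype]
    exact map_mono hQ
  refine ⟨Q, (Subgroup.eq_of_le_of_card_ge h1 ?_).symm⟩
  have h2 : (Q : Subgroup C).map C.subtype ≤
      ((P : Subgroup G) ⊓ C).map (MulAut.conj g).toMonoidHom := by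
    intro y hy
    have hyC := map_subtype_le _ hy
    have hyP := hP' hy
    rw [← hg] at hyP
    obtain ⟨z, hz, rfl⟩ := hyP
    refine ⟨z, ⟨hz, ?_⟩, rfl⟩
    have := Normal.conj_mem (inferInstance : C.Normal) _ hyC g⁻¹
    change g⁻¹ * (g * z * g⁻¹) * g⁻¹⁻¹ ∈ C at this
    simpa [mul_assoc] using this
  have h3 := card_le_of_le h2
  rwa [card_map_of_injective (f := (MulAut.conj g).toMonoidHom) (MulAut.conj g).injective] at h3

theorem normalizer_inf_sup_eq_top [Finite G] {s : ℕ} [Fact s.Prime] (P : Sylow s G)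
    (C : Subgroup G) [C.Normal] :
    C ⊔ normalizer (((P : Subgroup G) ⊓ C : Subgroup G) : Set G) = ⊤ := by
  obtain ⟨Q, hQ⟩ := exists_sylow_map_eq_inf P C
  rw [← hQ, sup_comm]
  exact Q.normalizer_sup_eq_top

end CharacteristicSubgroups

section TrivialCore

open scoped commutatorElement

variable {G A : Type} [Group G] [Finite G] [Group A] {ι φ : A →* G} {p n : ℕ}

theorem exists_prime_pCore_ne_bot (G : Type*) [Group G] [Finite G] [Nontrivial G]
    [Group.IsSolvable G] : ∃ s, s.Prime ∧ pCore s (⊤ : Subgroup G) ≠ ⊥ := by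
  by_contra! h
  have key : (⊥ : Subgroup G) = ⊤ := by
    refine eq_top_of_sylow_le fun t ht => ?_
    have := Fact.mk ht
    obtain ⟨Q⟩ := (inferInstance : Nonempty (Sylow t G))
    refine ⟨Q, ?_⟩
    rw [← h t ht]
    refine le_pCore_of_forall_le_centralizer Q.isPGroup' fun r hr => ?_
    rw [h r hr]
    intro x _
    rw [mem_centralizer_iff]
    rintro _ rfl
    simp
  exact bot_ne_top key

omit [Finite G] in
theorem pCore_top_le_pCore {p : ℕ} {L : Subgroup G} (h : pCore p (⊤ : Subgroup G) ≤ L) :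
    pCore p (⊤ : Subgroup G) ≤ pCore p L :=
  le_pCore h le_normalizer_of_normal (isPGroup_pCore p _)

omit [Finite G] in
theorem disjoint_of_isPGroup {M N : Subgroup G} {r s : ℕ} (hr : r.Prime) (hs : s.Prime)
    (h : r ≠ s) (hM : IsPGroup r M) (hN : IsPGroup s N) : Disjoint M N := by
  have := Fact.mk hr
  have := Fact.mk hs
  exact IsPGroup.disjoint_of_ne r s h M N hM hN

omit [Finite G] in
theorem le_normalizer_sup_of_commutator_le {L B D : Subgroup G} [D.Normal]
    (h : ⁅L, B⁆ ≤ B ⊔ D) : L ≤ normalizer ((B ⊔ D : Subgroup G) : Set G) := by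
  have key : ∀ g ∈ L, (B ⊔ D).map (MulAut.conj g).toMonoidHom ≤ B ⊔ D := by
    intro g hg
    rw [Subgroup.map_sup]
    refine sup_le ?_ ?_
    · rintro _ ⟨b, hb, rfl⟩
      have h1 : ⁅g, b⁆ * b ∈ B ⊔ D :=
        mul_mem (h (commutator_mem_commutator hg hb)) (mem_sup_left hb)
      rwa [commutatorElement_def, inv_mul_cancel_right] at h1
    · rintro _ ⟨d, hd, rfl⟩
      exact mem_sup_right (Normal.conj_mem inferInstance d hd g)
  refine le_normalizer_of_map_conj fun g hg => le_antisymm (key g hg) fun x hx => ?_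
  refine ⟨g⁻¹ * x * g, ?_, ?_⟩
  · have := key g⁻¹ (inv_mem hg) (mem_map_of_mem _ hx)
    simpa using this
  · simp [mul_assoc]

variable (IH : ∀ (N : Subgroup G) [N.Normal], N ≠ ⊥ → MaximalTransfer p n (G ⧸ N))

include IH in
theorem isCoatom_range_of_pCore_range_le (hp : p.Prime) {r : ℕ} (hr : r.Prime) (hrp : r ≠ p)
    (hι : Function.Injective ι) (hφ : Function.Injective φ) (hH : IsCoatom ι.range)
    (hidx : ι.range.index = p ^ n) (hF : pCore r (⊤ : Subgroup G) ≠ ⊥)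
    (h : pCore r ι.range ≤ pCore r ⊤) : IsCoatom φ.range := by
  have h1 := le_of_isPGroup_of_index hr hp hrp (isPGroup_pCore r (⊤ : Subgroup G)) hidx
  have h2 := le_of_isPGroup_of_index hr hp hrp (isPGroup_pCore r (⊤ : Subgroup G))
    ((index_range_eq hι hφ).trans hidx)
  have h3 : (pCore r (⊤ : Subgroup A)).map ι = pCore r (⊤ : Subgroup G) := by
    rw [map_pCore_top hι]
    exact le_antisymm h (pCore_top_le_pCore h1)
  have h4 : (pCore r (⊤ : Subgroup A)).map ι = (pCore r (⊤ : Subgroup A)).map φ := by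
    refine map_eq_map_of_map_le hφ hι ?_
    rw [h3, map_pCore_top hφ]
    exact pCore_top_le_pCore h2
  refine isCoatom_range_of_normal IH hι hφ hH hidx h4.symm ?_ inferInstance
  intro h0
  rw [h0, Subgroup.map_bot] at h3
  exact hF h3.symm

include IH in
theorem isCoatom_range_of_two_pCores [Group.IsSolvable G] (hp : p.Prime) {r s : ℕ} (hr : r.Prime)
    (hrp : r ≠ p) (hs : s.Prime) (hsp : s ≠ p) (hrs : r ≠ s)
    (hι : Function.Injective ι) (hφ : Function.Injective φ) (hH : IsCoatom ι.range)
    (hidx : ι.range.index = p ^ n) (hU : pCore p (⊤ : Subgroup G) = ⊥)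
    (hr0 : pCore r (⊤ : Subgroup G) ≠ ⊥) (hs0 : pCore s (⊤ : Subgroup G) ≠ ⊥) :
    IsCoatom φ.range := by
  have hFH : ∀ t, t.Prime → pCore t (⊤ : Subgroup G) ≤ ι.range := by
    intro t ht
    by_cases htp : t = p
    · rw [htp, hU]; exact bot_le
    · exact le_of_isPGroup_of_index ht hp htp (isPGroup_pCore t _) hidx
  have hcent : ∀ t u, t.Prime → u.Prime → t ≠ u →
      pCore t ι.range ≤ centralizer (pCore u (⊤ : Subgroup G) : Set G) := by
    intro t u ht hu htu
    exact le_centralizer_of_disjoint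
      (disjoint_of_isPGroup ht hu htu (isPGroup_pCore t _) (isPGroup_pCore u _))
      le_normalizer_of_normal ((hFH u hu).trans (le_normalizer_pCore t _))
  set C := centralizer (pCore s (⊤ : Subgroup G) : Set G) with hC
  have hCn : C.Normal := inferInstance
  by_cases hCH : C ≤ ι.range
  · refine isCoatom_range_of_pCore_range_le IH hp hr hrp hι hφ hH hidx hr0 ?_
    refine le_trans ?_ (pCore_le_of_normal r C)
    exact le_pCore (hcent r s hr hs hrs) (hCH.trans (le_normalizer_pCore r _))
      (isPGroup_pCore r _)
  · refine isCoatom_range_of_pCore_range_le IH hp hs hsp hι hφ hH hidx hs0 ?_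
    have htop : ι.range ⊔ C = ⊤ :=
      hH.2 _ (left_lt_sup.2 hCH)
    set D := pCoresCentralizer G with hD
    have hDH : D ≤ ι.range := by
      have := Fact.mk hp
      obtain ⟨Q⟩ := (inferInstance : Nonempty (Sylow p D))
      refine le_of_coprime_index ?_
      rw [hidx]
      refine Nat.Coprime.pow_right _ (Nat.Coprime.symm ((Nat.Prime.coprime_iff_not_dvd hp).2 ?_))
      intro hdvd
      obtain ⟨x, hx⟩ := exists_prime_orderOf_dvd_card' (G := D) p hdvd
      have h1 : zpowers (x : G) ≤ pCore p ⊤ := by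
        refine le_pCore_of_le_pCoresCentralizer ?_ ((zpowers_le).2 x.2)
        refine IsPGroup.of_card (n := 1) ?_
        rw [Nat.card_zpowers, Subgroup.orderOf_coe, hx, pow_one]
      rw [hU, le_bot_iff, zpowers_eq_bot] at h1
      rw [← Subgroup.orderOf_coe, h1, orderOf_one] at hx
      exact hp.one_lt.ne hx
    set B := pCore s ι.range with hB
    have hcomm : ⁅C, B⁆ ≤ D := by
      refine le_pCoresCentralizer fun t ht => ?_
      by_cases hts : t = s
      · subst hts
        exact commutator_le_left C B
      · exact (commutator_mono le_rfl (hcent s t hs ht (Ne.symm hts))).trans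
          (commutator_le_right C _)
    have hM : (B ⊔ D).Normal := by
      rw [← normalizer_eq_top_iff, ← top_le_iff, ← htop]
      refine sup_le ?_ ?_
      · exact le_normalizer_sup_of_commutator_le
          ((le_normalizer_iff_commutator_le_right.1 (le_normalizer_pCore s _)).trans le_sup_left)
      · exact le_normalizer_sup_of_commutator_le (hcomm.trans le_sup_right)
    refine le_trans ?_ (pCore_le_of_normal s (B ⊔ D))
    exact le_pCore le_sup_left
      ((sup_le (pCore_le s _) hDH).trans (le_normalizer_pCore s _)) (isPGroup_pCore s _)

end TrivialCore

section Offender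

variable {G A : Type} [Group G] [Finite G] [Group A] {ι φ : A →* G} {p n : ℕ}

theorem centralizer_pCore_le [Group.IsSolvable G] {s : ℕ}
    (h : ∀ r, r.Prime → r ≠ s → pCore r (⊤ : Subgroup G) = ⊥) :
    centralizer (pCore s (⊤ : Subgroup G) : Set G) ≤ pCore s ⊤ := by
  set C := centralizer (pCore s (⊤ : Subgroup G) : Set G) with hC
  rw [← subgroupOf_eq_top]
  refine eq_top_of_sylow_le fun t ht => ?_
  have := Fact.mk ht
  obtain ⟨Q⟩ := (inferInstance : Nonempty (Sylow t C))
  refine ⟨Q, map_le_iff_le_comap.1 ?_⟩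
  have h1 : (Q : Subgroup C).map C.subtype ≤ pCore t ⊤ := by
    refine le_pCore_of_forall_le_centralizer (Q.isPGroup'.map _) fun r hr => ?_
    by_cases hrs : r = s
    · subst hrs
      exact map_subtype_le _
    · rw [h r hr hrs, ← le_centralizer_iff]
      exact bot_le
  by_cases hts : t = s
  · subst hts; exact h1
  · rw [h t ht hts] at h1
    exact h1.trans bot_le

theorem exists_sylow_map_eq {f : A →* G} (hf : Function.Injective f) (hp : p.Prime) {s : ℕ}
    (hs : s.Prime) (hsp : s ≠ p) (hidx : f.range.index = p ^ n) (S : Sylow s A) :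
    ∃ P : Sylow s G, (P : Subgroup G) = (S : Subgroup A).map f := by
  have := Fact.mk hs
  have : Finite A := Finite.of_injective f hf
  have h2 : ¬ s ∣ ((S : Subgroup A).map f).index := by
    rw [index_map_of_injective _ hf, hidx, hs.dvd_mul]
    rintro (h | h)
    · exact S.not_dvd_index h
    · exact hsp ((Nat.prime_dvd_prime_iff_eq hs hp).1 (hs.dvd_of_dvd_pow h))
  exact ⟨(S.isPGroup'.map f).toSylow h2, rfl⟩

omit [Finite G] in
theorem isCoatom_range_conj_iff (φ : A →* G) (g : G) :
    IsCoatom ((MulAut.conj g).toMonoidHom.comp φ).range ↔ IsCoatom φ.range := by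
  rw [MonoidHom.range_comp]
  exact (MulAut.conj g).mapSubgroup.isCoatom_iff φ.range

theorem exists_common_sylow (hp : p.Prime) {s : ℕ} (hs : s.Prime) (hsp : s ≠ p)
    (hι : Function.Injective ι) (hφ : Function.Injective φ)
    (hidx : ι.range.index = p ^ n) :
    ∃ (φ' : A →* G) (S : Sylow s A) (P : Sylow s G), Function.Injective φ' ∧
      (IsCoatom φ'.range → IsCoatom φ.range) ∧ (S : Subgroup A).map ι = P ∧
      (S : Subgroup A).map φ' = P := by
  have := Fact.mk hs
  obtain ⟨S⟩ := (inferInstance : Nonempty (Sylow s A))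
  obtain ⟨P, hP⟩ := exists_sylow_map_eq hι hp hs hsp hidx S
  obtain ⟨P', hP'⟩ := exists_sylow_map_eq hφ hp hs hsp ((index_range_eq hι hφ).trans hidx) S
  obtain ⟨g, hg⟩ := MulAction.exists_smul_eq G P' P
  refine ⟨(MulAut.conj g).toMonoidHom.comp φ, S, P, (MulAut.conj g).injective.comp hφ,
    (isCoatom_range_conj_iff φ g).1, hP.symm, ?_⟩
  rw [← map_map, ← hP', ← hg]
  rfl

omit [Finite G] in
theorem sup_centralizer_le_centralizer_omegaCenter {s : ℕ} {P Z : Subgroup G} [Z.Normal]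
    (hZ : omegaCenter s P ≤ Z) :
    (P ⊔ centralizer (Z : Set G) : Subgroup G) ≤ centralizer (omegaCenter s P : Set G) := by
  refine sup_le ?_ (centralizer_le hZ)
  rw [le_centralizer_iff]
  exact fun z hz => mem_centralizer_iff.2 fun y hy => (hz.2.1 y hy).eq

variable (IH : ∀ (N : Subgroup G) [N.Normal], N ≠ ⊥ → MaximalTransfer p n (G ⧸ N))

include IH in
theorem isCoatom_range_or_exists_offender {s : ℕ} (hs : s.Prime)
    (hι : Function.Injective ι) (hφ : Function.Injective φ) (hH : IsCoatom ι.range)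
    (hidx : ι.range.index = p ^ n) (hF : pCore s (⊤ : Subgroup G) ≠ ⊥)
    (hCF : centralizer (pCore s (⊤ : Subgroup G) : Set G) ≤ pCore s ⊤)
    (S : Sylow s A) (P : Sylow s G) (hSι : (S : Subgroup A).map ι = P)
    (hSφ : (S : Subgroup A).map φ = P) :
    IsCoatom φ.range ∨ ∃ Z : Subgroup G, Z.Normal ∧ IsElementary s Z ∧
      omegaCenter s (P : Subgroup G) ≤ Z ∧ Z ≤ P ∧ centralizer (Z : Set G) ≤ ι.range ∧
      (∀ T : Subgroup G, T.Normal → T ≤ (P : Subgroup G) ⊔ centralizer (Z : Set G) →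
        T ≤ centralizer (Z : Set G)) ∧
      ∃ N, IsMaxElementary s (P : Subgroup G) N ∧ ¬ N ≤ centralizer (Z : Set G) := by
  have := Fact.mk hs
  set F := pCore s (⊤ : Subgroup G) with hFdef
  have hFP : F ≤ P := (isPGroup_pCore s _).le_sylow_of_normal P
  have hP0 : (P : Subgroup G) ≠ ⊥ := fun h => hF (le_bot_iff.1 (h ▸ hFP))
  have hA : Finite A := Finite.of_injective ι hι
  have hS0 : (S : Subgroup A) ≠ ⊥ := by
    intro h
    rw [h, Subgroup.map_bot] at hSι
    exact hP0 hSι.symm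
  set Z0 := omegaCenter s (P : Subgroup G) with hZ0
  have hZ0F : Z0 ≤ omegaCenter s F := by
    have h1 : Z0 ≤ F := by
      refine le_trans ?_ hCF
      intro z hz
      exact mem_centralizer_iff.2 fun y hy => (hz.2.1 y (hFP hy)).eq
    exact fun z hz => ⟨h1 hz, fun y hy => hz.2.1 y (hFP hy), hz.2.2⟩
  set Z := normalClosure (Z0 : Set G) with hZ
  have hZn : Z.Normal := normalClosure_normal
  have hOn := normal_omegaCenter s F
  have hZF : Z ≤ omegaCenter s F := normalClosure_le_normal hZ0F
  have hZ0Z : Z0 ≤ Z := subset_normalClosure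
  set C := centralizer (Z : Set G) with hC
  have hCZ0 := sup_centralizer_le_centralizer_omegaCenter hZ0Z
  have hCn : C.Normal := inferInstance
  by_cases hCH : C ≤ ι.range
  swap
  · left
    have htop : ι.range ⊔ C = ⊤ := hH.2 _ (left_lt_sup.2 hCH)
    refine isCoatom_range_of_factorization IH hι hφ hH hidx
      (X := omegaCenter s (S : Subgroup A)) ?_ (omegaCenter_ne_bot S.isPGroup' hS0) ?_
    · rw [map_omegaCenter hι, map_omegaCenter hφ, hSι, hSφ]
    · intro g
      obtain ⟨_, ⟨a, rfl⟩, c, hc, rfl⟩ := mem_sup_of_normal_right.1 (htop ▸ mem_top g)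
      refine ⟨a, c, ?_, rfl⟩
      rw [map_omegaCenter hι, hSι]
      exact centralizer_le_normalizer _ (hCZ0 (mem_sup_right hc))
  by_cases hN : ∃ N, IsMaxElementary s (P : Subgroup G) N ∧ ¬ N ≤ C
  · right
    refine ⟨Z, hZn, (isElementary_omegaCenter s F).mono hZF, hZ0Z,
      hZF.trans ((omegaCenter_le s F).trans hFP), hCH, fun T hT hTP => ?_, hN⟩
    rw [le_centralizer_iff]
    have h1 := hTP.trans hCZ0
    rw [le_centralizer_iff] at h1
    exact normalClosure_le_normal h1
  · left
    push Not at hN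
    refine isCoatom_range_of_factorization IH hι hφ hH hidx
      (X := thompsonSubgroup s (S : Subgroup A)) ?_ (thompsonSubgroup_ne_bot S.isPGroup' hS0) ?_
    · rw [map_thompsonSubgroup hι, map_thompsonSubgroup hφ, hSι, hSφ]
    · intro g
      obtain ⟨c, hc, m, hm, rfl⟩ :=
        mem_sup_of_normal_left.1 (normalizer_inf_sup_eq_top P C ▸ mem_top g)
      obtain ⟨a, rfl⟩ := hCH hc
      refine ⟨a, m, ?_, rfl⟩
      rw [map_thompsonSubgroup hι, hSι, ← thompsonSubgroup_inf hN]
      exact normalizer_le_normalizer_thompsonSubgroup s _ hm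

end Offender

section ConjRepresentation

variable {G : Type*} [Group G]

theorem exists_conj_representation {s : ℕ} {Z : Subgroup G} [Z.Normal] {V : Type*}
    [AddCommGroup V] [Module (ZMod s) V] (e : V ≃ Z) (he : ∀ u v, e (u + v) = e u * e v) :
    ∃ ρ : G ⧸ centralizer (Z : Set G) →* Module.End (ZMod s) V, Function.Injective ρ ∧
      ∀ (g : G) (u : V), (e (ρ g u) : G) = g * e u * g⁻¹ := by
  let c : G → V →+ V := fun g => AddMonoidHom.mk' (fun u => e.symm (MulAut.conjNormal g (e u)))
    fun u v => e.injective (by simp only [he, map_mul, Equiv.apply_symm_apply])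
  have hc : ∀ (g : G) (u : V), (e (c g u) : G) = g * e u * g⁻¹ := fun g u => by
    change ((e (e.symm _) : Z) : G) = _
    rw [Equiv.apply_symm_apply, MulAut.conjNormal_apply]
  let ρ₀ : G →* Module.End (ZMod s) V :=
    { toFun := fun g => (c g).toZModLinearMap s
      map_one' := LinearMap.ext fun u => e.injective (Subtype.ext (by
        rw [AddMonoidHom.coe_toZModLinearMap, hc]
        simp))
      map_mul' := fun g h => LinearMap.ext fun u => e.injective (Subtype.ext (by
        rw [Module.End.mul_apply, AddMonoidHom.coe_toZModLinearMap,
          AddMonoidHom.coe_toZModLinearMap, AddMonoidHom.coe_toZModLinearMap, hc, hc, hc]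
        group)) }
  have hρ₀ : ∀ (g : G) (u : V), (e (ρ₀ g u) : G) = g * e u * g⁻¹ := hc
  have hker : ∀ g : G, ρ₀ g = 1 ↔ g ∈ centralizer (Z : Set G) := by
    intro g
    rw [mem_centralizer_iff]
    constructor
    · intro h z hz
      have h1 := hρ₀ g (e.symm ⟨z, hz⟩)
      rw [h, Module.End.one_apply, Equiv.apply_symm_apply] at h1
      exact eq_mul_inv_iff_mul_eq.1 h1
    · intro h
      refine LinearMap.ext fun u => e.injective (Subtype.ext ?_)
      rw [hρ₀, ← h _ (e u).2, mul_inv_cancel_right]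
      rfl
  refine ⟨QuotientGroup.lift _ ρ₀ fun g hg => (hker g).2 hg, ?_, hρ₀⟩
  rw [injective_iff_map_eq_one]
  intro a
  induction a using QuotientGroup.induction_on with
  | H g =>
    intro h
    exact (QuotientGroup.eq_one_iff g).2 ((hker g).1 h)

theorem IsElementary.exists_module {G : Type} [Group G] {s : ℕ} {Z : Subgroup G}
    (hZ : IsElementary s Z) :
    ∃ (V : Type) (_ : AddCommGroup V) (_ : Module (ZMod s) V) (e : V ≃ Z),
      ∀ u v, e (u + v) = e u * e v := by
  let _ : CommGroup Z := { (inferInstance : Group Z) with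
    mul_comm := fun a b => Subtype.ext (hZ.1 a a.2 b b.2).eq }
  exact ⟨Additive Z, inferInstance, AddCommGroup.zmodModule fun x =>
    Additive.toMul.injective (Subtype.ext (hZ.2 (Additive.toMul x : Z) (Additive.toMul x).2)),
    Additive.toMul, fun _ _ => rfl⟩

theorem card_map_quotient_mul_card_inf {G : Type*} [Group G] (N C : Subgroup G) [C.Normal] :
    Nat.card (N.map (QuotientGroup.mk' C)) * Nat.card (N ⊓ C : Subgroup G) = Nat.card N := by
  rw [← relIndex_ker, QuotientGroup.ker_mk', inf_comm, ← subgroupOf_map_subtype,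
    card_map_of_injective N.subtype_injective, mul_comm]
  exact card_mul_index _

theorem card_le_card_mul_card_fixedVectors {G : Type} [Group G] [Finite G] {s : ℕ}
    {Z P N : Subgroup G} [Z.Normal]
    (hZ : IsElementary s Z) (hZP : Z ≤ P) (hN : IsMaxElementary s P N) {V : Type*}
    [AddCommGroup V] [Module (ZMod s) V] (e : V ≃ Z)
    {ρ : G ⧸ centralizer (Z : Set G) →* Module.End (ZMod s) V}
    (hρ : ∀ (g : G) (u : V), (e (ρ g u) : G) = g * e u * g⁻¹) :
    Nat.card V ≤ Nat.card (N.map (QuotientGroup.mk' (centralizer (Z : Set G)))) *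
      Nat.card (fixedVectors ρ (N.map (QuotientGroup.mk' (centralizer (Z : Set G))))) := by
  set C := centralizer (Z : Set G) with hC
  set f := QuotientGroup.mk' C with hf
  have hV : Nat.card V = Nat.card Z := Nat.card_congr e
  have : Finite V := Finite.of_equiv _ e.symm
  have h1 : Nat.card N = Nat.card (N.map f) * Nat.card (N ⊓ C : Subgroup G) :=
    (card_map_quotient_mul_card_inf N C).symm
  have h2 : Nat.card (N ⊓ C ⊔ Z : Subgroup G) ≤ Nat.card N := by
    refine hN.2 _ (sup_le (inf_le_left.trans hN.1.1) hZP) ?_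
    exact (hN.1.2.mono inf_le_left).sup hZ fun a ha b hb =>
      (mem_centralizer_iff.1 ha.2 b hb).symm
  have h3 := card_sup_mul_card_inf (N ⊓ C) Z
  have h4 : Nat.card (N ⊓ C ⊓ Z : Subgroup G) ≤ Nat.card (fixedVectors ρ (N.map f)) := by
    refine Nat.card_le_card_of_injective
      (fun z => ⟨e.symm ⟨z, z.2.2⟩, ?_⟩) ?_
    · rintro _ ⟨g, hg, rfl⟩
      refine e.injective (Subtype.ext ?_)
      change (e (ρ (g : G ⧸ C) _) : G) = _
      rw [hρ, Equiv.apply_symm_apply, mul_inv_eq_iff_eq_mul]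
      exact hN.1.2.1 g hg z z.2.1.1
    · intro a b hab
      have := e.symm.injective (congrArg Subtype.val hab)
      exact Subtype.ext (congrArg (fun u : Z => (u : G)) this)
  have h5 : 0 < Nat.card (N ⊓ C : Subgroup G) := Nat.card_pos
  rw [hV]
  refine Nat.le_of_mul_le_mul_left ?_ h5
  calc Nat.card (N ⊓ C : Subgroup G) * Nat.card Z
      = Nat.card (N ⊓ C ⊔ Z : Subgroup G) * Nat.card (N ⊓ C ⊓ Z : Subgroup G) := h3.symm
    _ ≤ Nat.card N * Nat.card (fixedVectors ρ (N.map f)) := Nat.mul_le_mul h2 h4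
    _ = _ := by rw [h1]; ring

end ConjRepresentation

section LinearGroup

variable {Γ V : Type*} [Group Γ] {s : ℕ} [Fact s.Prime] [AddCommGroup V] [Module (ZMod s) V]

theorem card_units_end [Finite V] {k : ℕ} (hV : Nat.card V = s ^ k) :
    Nat.card (Module.End (ZMod s) V)ˣ = ∏ i : Fin k, (s ^ k - s ^ (i : ℕ)) := by
  have hk : Module.finrank (ZMod s) V = k := by
    have h := Module.natCard_eq_pow_finrank (K := ZMod s) (V := V)
    rw [hV, Nat.card_zmod] at h
    exact (Nat.pow_right_injective (Fact.out : s.Prime).two_le h).symm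
  have e := Units.mapEquiv
    (algEquivMatrix (Module.finBasisOfFinrankEq (ZMod s) V hk)).toMulEquiv
  rw [Nat.card_congr e.toEquiv]
  have h := Matrix.card_GL_field (𝔽 := ZMod s) k
  rwa [ZMod.card] at h

theorem injective_toHomUnits {M : Type*} [Monoid M] {ρ : Γ →* M} (hρ : Function.Injective ρ) :
    Function.Injective ρ.toHomUnits := fun _ _ h => hρ (congrArg Units.val h)

theorem card_dvd_card_units_end {ρ : Γ →* Module.End (ZMod s) V} (hρ : Function.Injective ρ) :
    Nat.card Γ ∣ Nat.card (Module.End (ZMod s) V)ˣ :=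
  card_dvd_of_injective ρ.toHomUnits (injective_toHomUnits hρ)

theorem two_mul_card_dvd_card {G : Type*} [Group G] [Finite G] {z : G} (hz : orderOf z = 2)
    (hc : z ∈ center G) {L : Subgroup G} (h : z ∉ L) : 2 * Nat.card L ∣ Nat.card G := by
  have hn : (zpowers z).Normal := ⟨fun x hx g => by
    rwa [mem_center_iff.1 (zpowers_le.2 hc hx) g, mul_inv_cancel_right]⟩
  have hd : L ⊓ zpowers z = ⊥ := by
    by_contra h0
    have h2 := card_dvd_of_le (inf_le_right : L ⊓ zpowers z ≤ _)
    rw [Nat.card_zpowers, hz, Nat.dvd_prime Nat.prime_two] at h2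
    rcases h2 with h2 | h2
    · exact h0 (card_eq_one.1 h2)
    · have h3 := Subgroup.eq_of_le_of_card_ge (inf_le_right : L ⊓ zpowers z ≤ _)
        (by rw [h2, Nat.card_zpowers, hz])
      exact h (h3.ge (mem_zpowers z)).1
  have h2 := card_sup_mul_card_inf L (zpowers z)
  rw [hd, card_bot, mul_one, Nat.card_zpowers, hz, mul_comm] at h2
  rw [← h2]
  exact card_subgroup_dvd_card _

theorem zmod_two_ne_zero (hs2 : s ≠ 2) : (2 : ZMod s) ≠ 0 := fun h0 => hs2
  ((Nat.prime_dvd_prime_iff_eq Fact.out Nat.prime_two).1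
    ((ZMod.natCast_eq_zero_iff 2 s).1 (mod_cast h0)))

theorem neg_ne_self_of_ne_two (hs2 : s ≠ 2) {v : V} (hv : v ≠ 0) : -v ≠ v := fun h2 => by
  have h3 : (2 : ZMod s) • v = 0 := by
    rw [two_smul]; nth_rewrite 1 [← h2]; exact neg_add_cancel v
  exact hv ((smul_eq_zero.1 h3).resolve_left (zmod_two_ne_zero hs2))

theorem two_mul_card_dvd_card_units_end [Finite V] (hs2 : s ≠ 2) (hV : 1 < Nat.card V)
    {ρ : Γ →* Module.End (ZMod s) V}
    (hρ : Function.Injective ρ) (h : ∀ z, ρ z ≠ -1) :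
    2 * Nat.card Γ ∣ Nat.card (Module.End (ZMod s) V)ˣ := by
  set E := Module.End (ZMod s) V
  have : Finite E := DFunLike.finite E
  have : Nontrivial V := Finite.one_lt_card_iff_nontrivial.1 hV
  have h1 : orderOf (-1 : Eˣ) = 2 := by
    refine orderOf_eq_prime (by simp) fun h0 => ?_
    obtain ⟨v, hv⟩ := exists_ne (0 : V)
    exact neg_ne_self_of_ne_two hs2 hv (congrArg (fun u : Eˣ => (u : E) v) h0)
  have hc : (-1 : Eˣ) ∈ center Eˣ := mem_center_iff.2 fun g => by simp
  rw [Nat.card_congr (ρ.toHomUnits.ofInjective (injective_toHomUnits hρ)).toEquiv]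
  refine two_mul_card_dvd_card h1 hc ?_
  rintro ⟨z, hz⟩
  exact h z (congrArg Units.val hz)

end LinearGroup

section LinearGroupOffenders

variable {Γ V : Type*} [Group Γ] [Finite Γ] {s : ℕ} [Fact s.Prime] [AddCommGroup V]
  [Module (ZMod s) V] [Finite V]

theorem exists_dualTransvections_of_offender [Group.IsSolvable Γ]
    {ρ : Γ →* Module.End (ZMod s) V} (hρ : Function.Injective ρ)
    (hΓ : pCore s (⊤ : Subgroup Γ) = ⊥) {N : Subgroup Γ} (hN : N ≠ ⊥) (hNe : IsElementary s N)
    (hcard : Nat.card V ≤ Nat.card N * Nat.card (fixedVectors ρ N)) :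
    ∃ (x y : Γ) (α β : V →ₗ[ZMod s] ZMod s) (v w : V), DualTransvections ρ x y α β v w := by
  obtain ⟨x, hx, hxV⟩ := exists_transvection_of_offender hρ hΓ hN hNe.1 hNe.2 hcard
  exact exists_dualTransvections hρ hΓ hx hxV

omit [Finite Γ] [Finite V] in
theorem DualTransvections.neg_one_notMem {ρ : Γ →* Module.End (ZMod s) V} {x y : Γ}
    {α β : V →ₗ[ZMod s] ZMod s} {v w : V} (h : DualTransvections ρ x y α β v w) (hs2 : s ≠ 2)
    (hV : s ^ 2 < Nat.card V) {z : Γ} (hz : ρ z = -1) : z ∉ (closure {x, y} : Subgroup Γ) := by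
  obtain ⟨u, hu, hu0⟩ : ∃ u, (α u = 0 ∧ β u = 0) ∧ u ≠ 0 := by
    by_contra! h0
    have hinj : Function.Injective (α.prod β) := by
      rw [← LinearMap.ker_eq_bot, LinearMap.ker_eq_bot']
      intro m hm
      exact h0 m (Prod.mk.inj hm)
    have h1 := Nat.card_le_card_of_injective _ hinj
    rw [Nat.card_prod, Nat.card_zmod, ← sq] at h1
    omega
  intro hzL
  have key : ∀ g ∈ (closure {x, y} : Subgroup Γ), ρ g u = u := by
    intro g hg
    induction hg using closure_induction with
    | mem g hg =>
      rcases hg with rfl | rfl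
      · rw [h.left, hu.1, zero_smul, add_zero]
      · rw [h.right, hu.2, zero_smul, add_zero]
    | one => rw [map_one, Module.End.one_apply]
    | mul a b _ _ ha hb => rw [apply_mul_apply, hb, ha]
    | inv a _ ha => nth_rewrite 1 [← ha]; exact inv_apply_apply a u
  have h1 := key z hzL
  rw [hz] at h1
  exact neg_ne_self_of_ne_two hs2 hu0 h1

theorem DualTransvections.not_isCoatom {V : Type*} [AddCommGroup V] [Module (ZMod 3) V] [Finite V]
    {ρ : Γ →* Module.End (ZMod 3) V} (hρ : Function.Injective ρ) {M : Subgroup Γ} {n k : ℕ}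
    (hidx : M.index = 2 ^ n) (hn : 2 ≤ n) (hV : Nat.card V = 3 ^ k) (hk : k ≤ 3) {x y : M}
    {α β : V →ₗ[ZMod 3] ZMod 3} {v w : V}
    (h : DualTransvections (ρ.comp M.subtype) x y α β v w) : ¬ IsCoatom M := by
  intro hM
  have hU := card_units_end (s := 3) hV
  have h8 : 8 ∣ Nat.card (closure {x, y} : Subgroup M) := h.sq_sub_one_dvd_card
  have h4 : 4 ∣ 2 ^ n := pow_dvd_pow 2 hn
  have hΓ := M.card_mul_index
  rw [hidx] at hΓ
  have hdvd := card_dvd_card_units_end hρ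
  have h32 : 8 * 4 ∣ Nat.card Γ := by
    rw [← hΓ]
    exact mul_dvd_mul (h8.trans (card_subgroup_dvd_card _)) h4
  have hk3 : k = 3 := by
    by_contra hk3
    have h1 := h32.trans hdvd
    rw [hU] at h1
    have : k < 3 := by omega
    interval_cases k <;> revert h1 <;> decide
  subst hk3
  have hU3 : Nat.card (Module.End (ZMod 3) V)ˣ = 11232 := by rw [hU]; decide
  rw [hU3] at hdvd
  by_cases hneg : ∀ z, ρ z ≠ -1
  · have h1 := two_mul_card_dvd_card_units_end (by decide) (by rw [hV]; decide) hρ hneg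
    rw [hU3] at h1
    have h2 := (mul_dvd_mul_left 2 h32).trans h1
    revert h2; decide
  push Not at hneg
  obtain ⟨z, hz⟩ := hneg
  have hz2 : orderOf z = 2 := by
    refine orderOf_eq_prime (hρ ?_) ?_
    · rw [map_pow, hz, map_one]; simp
    · rintro rfl
      rw [map_one] at hz
      have : Nontrivial V := Finite.one_lt_card_iff_nontrivial.1 (by rw [hV]; decide)
      obtain ⟨v, hv⟩ := exists_ne (0 : V)
      exact neg_ne_self_of_ne_two (s := 3) (by decide) hv (congrArg (fun f => f v) hz).symm
  have hzc : ∀ g, g * z = z * g := fun g => hρ (by rw [map_mul, map_mul, hz]; simp)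
  by_cases hzM : z ∈ M
  · have h1 := h.neg_one_notMem (by decide) (by rw [hV]; decide) (z := ⟨z, hzM⟩) hz
    have h2 := two_mul_card_dvd_card (z := (⟨z, hzM⟩ : M))
      (by rw [← hz2, ← Subgroup.orderOf_coe])
      (mem_center_iff.2 fun g => Subtype.ext (hzc g)) h1
    have h3 : 2 * 8 * 4 ∣ Nat.card Γ := by
      rw [← hΓ]
      exact mul_dvd_mul ((mul_dvd_mul_left 2 h8).trans h2) h4
    have h4 := h3.trans hdvd
    revert h4; decide
  · have h1 : zpowers z ⊔ M = ⊤ := hM.2 _ (right_lt_sup.2 fun h => hzM (h (mem_zpowers z)))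
    have h2 := card_sup_zpowers_le (M := M) (x := z) (centralizer_le_normalizer _
      (mem_centralizer_iff.2 fun g _ => hzc g))
    rw [h1, card_top, hz2, ← hΓ, mul_comm] at h2
    have h3 := Nat.le_of_mul_le_mul_right h2 Nat.card_pos
    have h5 := Nat.pow_le_pow_right (n := 2) (by decide) hn
    omega

end LinearGroupOffenders

section FaithfulCase

variable {G A : Type} [Group G] [Finite G] [Group A] {ι φ : A →* G} {p n : ℕ}

theorem isCoatom_range_of_le_normalizer_sup
    (IH : ∀ (N : Subgroup G) [N.Normal], N ≠ ⊥ → MaximalTransfer p n (G ⧸ N)) {s : ℕ}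
    [Fact s.Prime] (hι : Function.Injective ι) (hφ : Function.Injective φ) (hH : IsCoatom ι.range)
    (hidx : ι.range.index = p ^ n) {S : Subgroup A} {P Z : Subgroup G} (hP : IsPGroup s P)
    (hP0 : P ≠ ⊥) (hSι : S.map ι = P) (hSφ : S.map φ = P) [Z.Normal]
    (hZ0 : omegaCenter s P ≤ Z) (hZP : Z ≤ P)
    (h : ι.range ≤ normalizer ((P ⊔ centralizer (Z : Set G) : Subgroup G) : Set G)) :
    IsCoatom φ.range := by
  have hXι : (omegaCenter s S).map ι = omegaCenter s P := by rw [map_omegaCenter hι, hSι]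
  refine isCoatom_range_of_normal IH hι hφ hH hidx (X := omegaCenter s S) ?_ ?_ ⟨fun x hx g => ?_⟩
  · rw [hXι, map_omegaCenter hφ, hSφ]
  · intro h0
    rw [h0, Subgroup.map_bot] at hXι
    exact omegaCenter_ne_bot hP hP0 hXι.symm
  · rw [← mem_map_iff_mem hι, hXι] at hx ⊢
    rw [map_mul, map_mul, map_inv]
    refine ⟨hZP (Normal.conj_mem inferInstance _ (hZ0 hx) _), fun y hy => ?_, ?_⟩
    · have h1 : (ι g)⁻¹ * y * ι g ∈ P ⊔ centralizer (Z : Set G) := by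
        have h2 := (mem_normalizer_iff.1 (inv_mem (h ⟨g, rfl⟩)) y).1 (mem_sup_left hy)
        rwa [inv_inv] at h2
      have h3 := mem_centralizer_iff.1 (sup_centralizer_le_centralizer_omegaCenter hZ0 h1) _ hx
      have h4 : Commute ((ι g)⁻¹ * y * ι g) (ι x) := h3.symm
      have h5 := h4.map (MulAut.conj (ι g)).toMonoidHom
      simpa [MulAut.conj_apply, mul_assoc] using h5
    · rw [conj_pow, hx.2.2, mul_one, mul_inv_cancel]

theorem pCore_quotient_eq_bot {s : ℕ} [Fact s.Prime] {C : Subgroup G} [C.Normal] (P : Sylow s G)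
    (h : ∀ T : Subgroup G, T.Normal → T ≤ (P : Subgroup G) ⊔ C → T ≤ C) :
    pCore s (⊤ : Subgroup (G ⧸ C)) = ⊥ := by
  have hf := QuotientGroup.mk'_surjective C
  set f := QuotientGroup.mk' C
  have h1 : pCore s (⊤ : Subgroup (G ⧸ C)) ≤ (P : Subgroup G).map f :=
    (isPGroup_pCore s _).le_sylow_of_normal (P.mapSurjective hf)
  have h2 := h ((pCore s ⊤).comap f) inferInstance (by
    refine (comap_mono h1).trans ?_
    rw [comap_map_eq, QuotientGroup.ker_mk'])
  have h3 := map_mono (f := f) h2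
  rwa [map_comap_eq_self_of_surjective hf, (map_eq_bot_iff C).2 (QuotientGroup.ker_mk' C).ge,
    le_bot_iff] at h3

theorem card_map_dvd_three {C : Subgroup G} [C.Normal] (P : Sylow 3 G) {Z : Subgroup G}
    (hZP : Z ≤ P) (hZC : Z ≤ C) (hP : Nat.card P ≤ 3 ^ 4) {k : ℕ} (hZ : Nat.card Z = 3 ^ k)
    (hk : k ≤ 3) (hdvd : Nat.card (G ⧸ C) ∣ ∏ i : Fin k, (3 ^ k - 3 ^ (i : ℕ))) :
    Nat.card ((P : Subgroup G).map (QuotientGroup.mk' C)) ∣ 3 := by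
  have : Fact (Nat.Prime 3) := ⟨Nat.prime_three⟩
  set f := QuotientGroup.mk' C with hf
  obtain ⟨j, hj⟩ := IsPGroup.iff_card.1 (P.isPGroup'.map f)
  have hmul := card_map_quotient_mul_card_inf (P : Subgroup G) C
  rw [← hf] at hmul
  have hdvd' := (card_subgroup_dvd_card ((P : Subgroup G).map f)).trans hdvd
  change Nat.card ((P : Subgroup G).map f) ∣ 3
  rw [hj] at hdvd' hmul ⊢
  have hj1 : j ≤ 1 := by
    by_contra! h2
    have h9 : 3 ^ 2 ∣ ∏ i : Fin k, (3 ^ k - 3 ^ (i : ℕ)) := (pow_dvd_pow 3 h2).trans hdvd'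
    have hk3 : k = 3 := by
      by_contra hk3
      have : k ≤ 2 := by omega
      interval_cases k <;> revert h9 <;> decide
    subst hk3
    have h27 := Nat.card_le_card_of_injective _ (inclusion_injective (le_inf hZP hZC))
    have h9' := Nat.pow_le_pow_right (show 0 < 3 by norm_num) h2
    rw [hZ] at h27
    nlinarith
  exact (pow_dvd_pow 3 hj1).trans (by norm_num)

theorem isCoatom_range_of_pCore_eq_bot [Group.IsSolvable G] (hp : p.Prime) (hp3 : p ≤ 3)
    (hn : 2 ≤ n) (IH : ∀ (N : Subgroup G) [N.Normal], N ≠ ⊥ → MaximalTransfer p n (G ⧸ N))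
    (hι : Function.Injective ι) (hφ : Function.Injective φ) (hH : IsCoatom ι.range)
    (hidx : ι.range.index = p ^ n) (hU : pCore p (⊤ : Subgroup G) = ⊥)
    (hsmall : (Nat.card G).factorization (5 - p) ≤ 4) : IsCoatom φ.range := by
  have : Nontrivial G := by
    by_contra h
    rw [not_nontrivial_iff_subsingleton] at h
    exact hH.1 (Subsingleton.elim _ _)
  obtain ⟨s, hs, hF⟩ := exists_prime_pCore_ne_bot G
  have hsp : s ≠ p := by rintro rfl; exact hF hU
  by_cases hr : ∃ r, r.Prime ∧ r ≠ s ∧ pCore r (⊤ : Subgroup G) ≠ ⊥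
  · obtain ⟨r, hr, hrs, hr0⟩ := hr
    exact isCoatom_range_of_two_pCores IH hp hr (by rintro rfl; exact hr0 hU) hs hsp hrs hι hφ hH
      hidx hU hr0 hF
  push Not at hr
  have := Fact.mk hs
  obtain ⟨φ', S, P, hφ', hφφ', hSι, hSφ⟩ := exists_common_sylow hp hs hsp hι hφ hidx
  refine hφφ' ?_
  rcases isCoatom_range_or_exists_offender IH hs hι hφ' hH hidx hF (centralizer_pCore_le hr) S P
    hSι hSφ with h | ⟨Z, hZn, hZe, hZ0, hZP, hCH, hT, N, hN, hNC⟩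
  · exact h
  have hP0 : (P : Subgroup G) ≠ ⊥ := fun h => hNC ((hN.1.1.trans h.le).trans bot_le)
  have hZC : Z ≤ centralizer (Z : Set G) := fun z hz =>
    mem_centralizer_iff.2 fun y hy => (hZe.1 y hy z hz).eq
  obtain ⟨V, _, _, e, he⟩ := hZe.exists_module
  obtain ⟨ρ, hρ, hρe⟩ := exists_conj_representation (s := s) e he
  have hcard := card_le_card_mul_card_fixedVectors hZe hZP hN e hρe
  have hV : Finite V := Finite.of_equiv _ e.symm
  set C := centralizer (Z : Set G) with hC
  have hf := QuotientGroup.mk'_surjective C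
  have hker := QuotientGroup.ker_mk' C
  have hΓ := pCore_quotient_eq_bot P hT
  set f := QuotientGroup.mk' C with hfdef
  have hN0 : N.map f ≠ ⊥ := by rwa [Ne, Subgroup.map_eq_bot_iff, hker]
  have hNe := hN.1.2.map f
  by_cases hs23 : s ≠ 2 ∧ s ≠ 3
  · obtain ⟨x, y, α, β, v, w, h⟩ := exists_dualTransvections_of_offender hρ hΓ hN0 hNe hcard
    exact absurd (inferInstance : Group.IsSolvable (G ⧸ C)) (h.not_isSolvable hρ hs23.1 hs23.2)
  have hp2 := hp.two_le
  have hs5 : s = 5 - p := by omega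
  have hMcoatom : IsCoatom (ι.range.map f) := isCoatom_map_of_surjective hf hH (hker.le.trans hCH)
  have hMidx : (ι.range.map f).index = p ^ n := by rw [index_map_eq _ hf (hker.le.trans hCH), hidx]
  obtain ⟨k, hk⟩ := IsPGroup.iff_card.1 hZe.isPGroup
  have hPcard : Nat.card P ≤ s ^ 4 := by
    rw [P.card_eq_multiplicity, hs5]
    exact Nat.pow_le_pow_right (hs5 ▸ hs.pos) hsmall
  have hk3 : k ≤ 3 := by
    by_contra! h4
    have h5 := Nat.pow_le_pow_right hs.pos h4
    have h6 := eq_of_le_of_card_ge hZP (by rw [hk]; exact hPcard.trans h5)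
    exact hNC ((hN.1.1.trans h6.ge).trans hZC)
  have hVk : Nat.card V = s ^ k := (Nat.card_congr e).trans hk
  have hdvd : Nat.card (G ⧸ C) ∣ ∏ i : Fin k, (s ^ k - s ^ (i : ℕ)) :=
    card_units_end hVk ▸ card_dvd_card_units_end hρ
  obtain rfl | rfl : p = 2 ∨ p = 3 := by omega
  · obtain rfl : s = 3 := by omega
    have hP3 := card_map_dvd_three P hZP hZC hPcard hk hk3 hdvd
    have hPι : ((P : Subgroup G).map f) ≤ ι.range.map f := by
      rw [← hSι]; exact map_mono (map_le_range ι _)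
    by_cases hM : pCore 3 (ι.range.map f) = ⊥
    · exfalso
      have hNM : N.map f ≤ ι.range.map f := (map_mono hN.1.1).trans hPι
      set M := ι.range.map f with hMdef
      have hM' : pCore 3 (⊤ : Subgroup M) = ⊥ := by
        rw [← map_eq_bot_iff_of_injective _ M.subtype_injective, map_pCore_top M.subtype_injective,
          M.range_subtype, hM]
      have hfix : fixedVectors (ρ.comp M.subtype) ((N.map f).subgroupOf M) =
          fixedVectors ρ (N.map f) := by
        ext u
        exact ⟨fun h m hm => h ⟨m, hNM hm⟩ hm, fun h m hm => h m hm⟩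
      obtain ⟨x, y, α, β, v, w, h⟩ := exists_dualTransvections_of_offender
        (ρ := ρ.comp M.subtype) (N := (N.map f).subgroupOf M) (hρ.comp M.subtype_injective) hM'
        (fun h0 => hN0 (by
          rw [← map_subgroupOf_eq_of_le hNM, h0, Subgroup.map_bot]))
        (hNe.comap M.subtype_injective)
        (by rwa [hfix, Nat.card_congr (subgroupOfEquivOfLe hNM).toEquiv])
      exact h.not_isCoatom hρ hMidx hn hVk hk3 hMcoatom
    · refine isCoatom_range_of_le_normalizer_sup IH hι hφ' hH hidx P.isPGroup' hP0 hSι hSφ hZ0 hZP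
        ?_
      have hle : pCore 3 (ι.range.map f) ≤ (P : Subgroup G).map f := by
        have h1 := (isPGroup_pCore 3 (⊤ : Subgroup (ι.range.map f))).le_sylow_of_normal
          ((P.mapSurjective hf).subtype hPι)
        have h2 := map_mono (f := (ι.range.map f).subtype) h1
        rw [map_pCore_top (ι.range.map f).subtype_injective, range_subtype] at h2
        exact h2.trans (map_subgroupOf_eq_of_le hPι).le
      have heq : pCore 3 (ι.range.map f) = (P : Subgroup G).map f := by
        refine eq_of_le_of_card_ge hle ?_
        rcases (Nat.dvd_prime Nat.prime_three).1 ((card_dvd_of_le hle).trans hP3) with h1 | h1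
        · exact absurd (card_eq_one.1 h1) hM
        · rw [h1]; exact Nat.le_of_dvd (by norm_num) hP3
      have h1 := le_normalizer_pCore 3 (ι.range.map f)
      rw [heq] at h1
      have h2 := (map_le_iff_le_comap.1 h1).trans (le_normalizer_comap f)
      rwa [comap_map_eq, hker] at h2
  · obtain rfl : s = 2 := by omega
    exfalso
    have h9 : 3 ^ 2 ∣ ∏ i : Fin k, (2 ^ k - 2 ^ (i : ℕ)) :=
      (pow_dvd_pow 3 hn).trans ((hMidx ▸ index_dvd_card _).trans hdvd)
    interval_cases k <;> revert h9 <;> decide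

end FaithfulCase

section Reduction

variable {p n : ℕ}

theorem maximalTransfer_of_factorization_le (hp : p.Prime) (hp3 : p ≤ 3) (hn : 2 ≤ n) (G : Type)
    [Group G] [Finite G] [Group.IsSolvable G]
    (hsmall : (Nat.card G).factorization (5 - p) ≤ 4) : MaximalTransfer p n G := by
  induction hc : Nat.card G using Nat.strong_induction_on generalizing G with
  | _ c ih =>
    subst hc
    have IH : ∀ (N : Subgroup G) [N.Normal], N ≠ ⊥ → MaximalTransfer p n (G ⧸ N) := by
      intro N _ hN
      have hdvd : Nat.card (G ⧸ N) ∣ Nat.card G := card_quotient_dvd_card N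
      refine ih _ ?_ (G ⧸ N) ?_ rfl
      · refine lt_of_le_of_ne (Nat.le_of_dvd Nat.card_pos hdvd) fun h => hN ?_
        have h1 := N.card_eq_card_quotient_mul_card_subgroup
        rw [h] at h1
        exact card_eq_one.1 (Nat.eq_of_mul_eq_mul_left Nat.card_pos (by rw [← h1, mul_one]))
      · exact ((Nat.factorization_le_iff_dvd Nat.card_pos.ne' Nat.card_pos.ne').2 hdvd _).trans
          hsmall
    intro A _ ι φ hι hφ hH hidx
    by_cases hU : pCore p (⊤ : Subgroup G) = ⊥
    · exact isCoatom_range_of_pCore_eq_bot hp hp3 hn IH hι hφ hH hidx hU hsmall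
    · exact isCoatom_range_of_pCore_ne_bot hp IH hι hφ hH hidx hU

theorem isCoatom_of_index_prime {G : Type*} [Group G] {K : Subgroup G} (hp : p.Prime)
    (h : K.index = p) : IsCoatom K := by
  refine ⟨fun h1 => ?_, fun L hL => ?_⟩
  · rw [h1, index_top] at h
    exact hp.one_lt.ne h
  · have hmul := relIndex_mul_index hL.le
    rcases (Nat.dvd_prime hp).1 (h ▸ index_dvd_of_le hL.le) with h1 | h1
    · exact index_eq_one.1 h1
    · rw [h, h1] at hmul
      exact absurd (relIndex_eq_one.1 (Nat.eq_of_mul_eq_mul_right hp.pos (by rw [hmul, one_mul])))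
        hL.not_ge

end Reduction

end

/-- **Theorem 1.4.** Let `G` be a finite solvable group with isomorphic subgroups `H` and `K`,
where `H` is maximal of index `p ^ n` with `p ≤ 3` prime and `n ≥ 1`.  Set `q = 5 - p`.
If the `q`-part of `|G|` is at most `q ^ 4`, then `K` is also maximal in `G`. -/
theorem maximal_of_small_q_part
    (G : Type) [Group G] [Finite G] (hG : IsSolvable G)
    (H K : Subgroup G) (hiso : Nonempty (H ≃* K)) (hH : IsCoatom H)
    (p n : ℕ) (hp : p.Prime) (hn : 0 < n) (hidx : H.index = p ^ n)
    (hp3 : p ≤ 3) (q : ℕ) (hq : q = 5 - p) (Q : Sylow q H)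
    (hsmall : (Nat.card G).factorization q ≤ 4) :
    IsCoatom K := by
  obtain ⟨i⟩ := hiso
  subst hq
  have : Group.IsSolvable G := hG
  have hι := H.subtype_injective
  have hφ : Function.Injective (K.subtype.comp i.toMonoidHom) :=
    K.subtype_injective.comp i.injective
  have hrange : (K.subtype.comp i.toMonoidHom).range = K := by
    rw [MonoidHom.range_comp, MonoidHom.range_eq_top.2 i.surjective, ← MonoidHom.range_eq_map,
      K.range_subtype]
  rcases eq_or_ne n 1 with rfl | hn1
  · refine isCoatom_of_index_prime hp ?_
    rw [← hrange, index_range_eq hι hφ, H.range_subtype, hidx, pow_one]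
  · rw [← hrange]
    refine maximalTransfer_of_factorization_le (n := n) hp hp3 (by omega) G hsmall H H.subtype _ hι
      hφ ?_ ?_
    all_goals rwa [H.range_subtype]
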